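/- For every integer r ≥ 3 there exist γ > 0 and constants K, C > 0 such that if p = p(n) ≤ n^(−2/r+γ), then the probability that F_r(G(n,p(n))) ≤ exp(K·√n·(log n)^C)·Σ(n,m) tends to 1 as n → ∞ through multiples of r, where m = m(n) = ⌊C(n,r)·p(n)^(C(r,2))⌋. -/

import Mathlib

open Finset
open scoped Classical

/-- All 2-element subsets of `Fin n`: the potential edges of a graph on `[n]`. -/
def pairsUniv (n : ℕ) : Finset (Finset (Fin n)) :=
  Finset.powersetCard 2 (Finset.univ : Finset (Fin n))

/-- The probability that the random graph `G(n,p)` (identified with its edge set,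
a set of 2-element subsets of `Fin n`, each present independently with probability `p`)
lies in the family `A`. -/
noncomputable def gnpProb (n : ℕ) (p : ℝ) (A : Set (Finset (Finset (Fin n)))) : ℝ :=
  ∑ G ∈ (pairsUniv n).powerset.filter (· ∈ A),
    p ^ G.card * (1 - p) ^ ((pairsUniv n).card - G.card)

/-- The expectation of `f (G(n,p))`. -/
noncomputable def gnpExpect (n : ℕ) (p : ℝ) (f : Finset (Finset (Fin n)) → ℝ) : ℝ :=
  ∑ G ∈ (pairsUniv n).powerset,
    p ^ G.card * (1 - p) ^ ((pairsUniv n).card - G.card) * f G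

/-- The `r`-uniform hypergraph `H_r(G)` on `[n]` whose hyperedges are the `r`-element
vertex sets inducing a clique of the graph `G`. -/
def cliqueHyp (n r : ℕ) (G : Finset (Finset (Fin n))) : Finset (Finset (Fin n)) :=
  (Finset.powersetCard r (Finset.univ : Finset (Fin n))).filter
    (fun S => Finset.powersetCard 2 S ⊆ G)

/-- The graph `G(H)` whose edges are the vertex pairs contained in some hyperedge of `H`. -/
def hypGraph (n : ℕ) (H : Finset (Finset (Fin n))) : Finset (Finset (Fin n)) :=
  (pairsUniv n).filter (fun e => ∃ h ∈ H, e ⊆ h)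

/-- `t(H) = C(r,2)·e(H) − e(G(H))`. -/
def tHyp (n r : ℕ) (H : Finset (Finset (Fin n))) : ℤ :=
  (r.choose 2 : ℤ) * H.card - ((hypGraph n H).card : ℤ)

/-- `μ_r = C(n,r)·p^(C(r,2))`, the expected number of copies of `K_r` in `G(n,p)`. -/
noncomputable def muR (n r : ℕ) (p : ℝ) : ℝ := (n.choose r : ℝ) * p ^ r.choose 2

/-- The number of `K_r`-factors of the graph `G` on `[n]`: partitions of the vertex set
into `n/r` parts of size `r`, each inducing a clique of `G`. -/
noncomputable def numFactors (n r : ℕ) (G : Finset (Finset (Fin n))) : ℕ :=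
  (((Finset.powersetCard r (Finset.univ : Finset (Fin n))).powerset).filter
    (fun P => P.card = n / r ∧ (∀ S ∈ P, ∀ T ∈ P, S ≠ T → S ∩ T = ∅) ∧
      (∀ v : Fin n, ∃ S ∈ P, v ∈ S) ∧
      ∀ S ∈ P, Finset.powersetCard 2 S ⊆ G)).card

/-- `Σ(n,m)`: the expected number of perfect matchings of the random `r`-uniform
hypergraph `H_r(n,m)` (for `r ∣ n`). -/
noncomputable def SigmaNM (n r m : ℕ) : ℝ :=
  ((n.factorial : ℝ) / ((r.factorial : ℝ) ^ (n / r) * ((n / r).factorial : ℝ))) *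
    ((m.descFactorial (n / r) : ℝ) / ((n.choose r).descFactorial (n / r) : ℝ))


set_option linter.unusedSectionVars false
section general
variable {α : Type*} [DecidableEq α]

/-- Expectation over a random `p`-subset of `U`. -/
noncomputable def EE (U : Finset α) (p : ℝ) (f : Finset α → ℝ) : ℝ :=
  ∑ G ∈ U.powerset, p ^ G.card * (1 - p) ^ (U.card - G.card) * f G

lemma EE_insert (U : Finset α) (p : ℝ) (f : Finset α → ℝ) (a : α) (ha : a ∉ U) :
    EE (insert a U) p f = EE U p (fun G => (1 - p) * f G + p * f (insert a G)) := by
  unfold EE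
  rw [Finset.sum_powerset_insert ha, ← Finset.sum_add_distrib]
  apply Finset.sum_congr rfl
  intro G hG
  rw [Finset.mem_powerset] at hG
  have haG : a ∉ G := fun h => ha (hG h)
  have hc := Finset.card_le_card hG
  rw [Finset.card_insert_of_notMem ha, Finset.card_insert_of_notMem haG,
    Nat.sub_add_comm hc, Nat.add_sub_add_right]
  ring

lemma EE_congr (U : Finset α) (p : ℝ) (f g : Finset α → ℝ) (h : ∀ G, G ⊆ U → f G = g G) :
    EE U p f = EE U p g := by
  unfold EE
  apply Finset.sum_congr rfl
  intro G hG
  rw [h G (Finset.mem_powerset.1 hG)]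

lemma EE_mono (U : Finset α) (p : ℝ) (hp0 : 0 < p) (hp1 : p < 1) (f g : Finset α → ℝ)
    (h : ∀ G, G ⊆ U → f G ≤ g G) :
    EE U p f ≤ EE U p g := by
  unfold EE
  apply Finset.sum_le_sum
  intro G hG
  have : 0 < 1 - p := by linarith
  exact mul_le_mul_of_nonneg_left (h G (Finset.mem_powerset.1 hG)) (by positivity)

lemma EE_nonneg (U : Finset α) (p : ℝ) (hp0 : 0 < p) (hp1 : p < 1) (f : Finset α → ℝ)
    (h : ∀ G, G ⊆ U → 0 ≤ f G) : 0 ≤ EE U p f := by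
  unfold EE
  apply Finset.sum_nonneg
  intro G hG
  have : 0 < 1 - p := by linarith
  exact mul_nonneg (by positivity) (h G (Finset.mem_powerset.1 hG))

lemma EE_sub' (U : Finset α) (p : ℝ) (f g : Finset α → ℝ) :
    EE U p (fun G => f G - g G) = EE U p f - EE U p g := by
  unfold EE
  rw [← Finset.sum_sub_distrib]
  apply Finset.sum_congr rfl
  intros; ring

lemma EE_add (U : Finset α) (p : ℝ) (f g : Finset α → ℝ) :
    EE U p (fun G => f G + g G) = EE U p f + EE U p g := by
  unfold EE
  rw [← Finset.sum_add_distrib]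
  apply Finset.sum_congr rfl
  intros; ring

lemma EE_smul (U : Finset α) (p c : ℝ) (f : Finset α → ℝ) :
    EE U p (fun G => c * f G) = c * EE U p f := by
  unfold EE
  rw [Finset.mul_sum]
  apply Finset.sum_congr rfl
  intros; ring

lemma EE_sum {ι : Type*} (U : Finset α) (p : ℝ) (s : Finset ι) (f : ι → Finset α → ℝ) :
    EE U p (fun G => ∑ i ∈ s, f i G) = ∑ i ∈ s, EE U p (f i) := by
  unfold EE
  rw [Finset.sum_comm]
  apply Finset.sum_congr rfl
  intros; rw [Finset.mul_sum]

lemma EE_const (U : Finset α) (p c : ℝ) : EE U p (fun _ => c) = c := by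
  unfold EE
  rw [← Finset.sum_mul, Finset.sum_pow_mul_eq_add_pow]
  simp

lemma EE_single (U : Finset α) (p : ℝ) (f : Finset α → ℝ) (a : α) (ha : a ∈ U) :
    EE U p (fun G => if a ∈ G then f G else 0) = p * EE U p (fun G => f (insert a G)) := by
  obtain ⟨V, hV, rfl⟩ : ∃ V, a ∉ V ∧ insert a V = U :=
    ⟨U.erase a, Finset.notMem_erase a U, Finset.insert_erase ha⟩
  rw [EE_insert V p _ a hV, EE_insert V p _ a hV, ← EE_smul]
  apply EE_congr
  intro G hG
  have haG : a ∉ G := fun h => hV (hG h)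
  simp only [haG, if_false, Finset.mem_insert_self, if_true, Finset.insert_idem]
  ring

lemma EE_subset (U : Finset α) (p : ℝ) (A : Finset α) (hA : A ⊆ U) (f : Finset α → ℝ) :
    EE U p (fun G => if A ⊆ G then f G else 0) = p ^ A.card * EE U p (fun G => f (G ∪ A)) := by
  induction A using Finset.induction_on generalizing f with
  | empty => simp
  | insert a A ha ih =>
    have h1 : a ∈ U := hA (Finset.mem_insert_self a A)
    have h2 : A ⊆ U := fun x hx => hA (Finset.mem_insert_of_mem hx)
    have : EE U p (fun G => if insert a A ⊆ G then f G else 0)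
        = EE U p (fun G => if A ⊆ G then (if a ∈ G then f G else 0) else 0) := by
      apply EE_congr
      intro G hG
      by_cases h : A ⊆ G <;> by_cases h' : a ∈ G <;> simp [Finset.insert_subset_iff, h, h']
    rw [this, ih h2]
    have : EE U p (fun G => if a ∈ G ∪ A then f (G ∪ A) else 0)
        = EE U p (fun G => if a ∈ G then f (G ∪ A) else 0) := by
      apply EE_congr
      intro G hG
      simp [ha]
    rw [this, EE_single U p _ a h1, Finset.card_insert_of_notMem ha, pow_succ, mul_assoc]
    congr 3
    funext G
    congr 1
    ext x; simp

lemma one_sub_sum_le_prod' {ι : Type*} (s : Finset ι) (c : ι → ℝ) (h : ∀ i ∈ s, 0 ≤ c i ∧ c i ≤ 1) :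
    1 - ∑ i ∈ s, c i ≤ ∏ i ∈ s, (1 - c i) := by
  classical
  induction s using Finset.induction_on with
  | empty => simp
  | insert a s ha ih =>
    rw [Finset.sum_insert ha, Finset.prod_insert ha]
    have h1 := ih (fun i hi => h i (Finset.mem_insert_of_mem hi))
    obtain ⟨h2, h3⟩ := h a (Finset.mem_insert_self a s)
    have h4 : ∏ i ∈ s, (1 - c i) ≤ 1 := Finset.prod_le_one
      (fun i hi => by linarith [(h i (Finset.mem_insert_of_mem hi)).2])
      (fun i hi => by linarith [(h i (Finset.mem_insert_of_mem hi)).1])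
    nlinarith

/-- A Janson-type inequality. -/
theorem janson {ι : Type*} [DecidableEq ι] (U : Finset α) (p x : ℝ) (hp0 : 0 < p) (hp1 : p < 1)
    (hx0 : 0 ≤ x) (hx1 : x ≤ 1) (A : ι → Finset α) (s : Finset ι) (hA : ∀ i ∈ s, A i ⊆ U) :
    EE U p (fun G => ∏ i ∈ s, (if A i ⊆ G then 1 - x else 1)) ≤
      Real.exp (-x * ∑ i ∈ s, p ^ (A i).card + x ^ 2 * ∑ i ∈ s, ∑ j ∈ s,
        if i ≠ j ∧ ¬ Disjoint (A i) (A j) then p ^ (A i ∪ A j).card else 0) := by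
  classical
  induction s using Finset.induction_on with
  | empty => simp [EE_const]
  | insert a s ha ih =>
    have ih := ih (fun i hi => hA i (Finset.mem_insert_of_mem hi))
    have hAa := hA a (Finset.mem_insert_self a s)
    have hAs : ∀ i ∈ s, A i ⊆ U := fun i hi => hA i (Finset.mem_insert_of_mem hi)
    set W : Finset α → ℝ := fun G => ∏ i ∈ s, (if A i ⊆ G then 1 - x else 1) with hW
    set N : Finset ι := s.filter (fun j => ¬ Disjoint (A a) (A j)) with hN
    set M : Finset ι := s.filter (fun j => ¬ ¬ Disjoint (A a) (A j)) with hM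
    set Z : Finset α → ℝ := fun G => ∏ i ∈ M, (if A i ⊆ G then 1 - x else 1) with hZ
    have hfac : ∀ (i : ι) (G : Finset α), 0 ≤ (if A i ⊆ G then 1 - x else 1) ∧
        (if A i ⊆ G then 1 - x else 1) ≤ 1 := by
      intro i G; split_ifs <;> constructor <;> linarith
    have hW0 : ∀ G, 0 ≤ W G := fun G => Finset.prod_nonneg (fun i _ => (hfac i G).1)
    have hZ0 : ∀ G, 0 ≤ Z G := fun G => Finset.prod_nonneg (fun i _ => (hfac i G).1)
    have hWs : ∀ G, W G = (∏ i ∈ N, (if A i ⊆ G then 1 - x else 1)) * Z G := by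
      intro G
      exact (Finset.prod_filter_mul_prod_filter_not s _ _).symm
    have hWZ : ∀ G, W G ≤ Z G := by
      intro G
      rw [hWs]
      have : (∏ i ∈ N, (if A i ⊆ G then 1 - x else 1)) ≤ 1 :=
        Finset.prod_le_one (fun i _ => (hfac i G).1) (fun i _ => (hfac i G).2)
      nlinarith [hZ0 G]
    have hZmono : ∀ G B, Z (G ∪ B) ≤ Z G := by
      intro G B
      apply Finset.prod_le_prod (fun i _ => (hfac i _).1)
      intro i _
      by_cases h : A i ⊆ G
      · have : A i ⊆ G ∪ B := h.trans Finset.subset_union_left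
        simp [h, this]
      · simp only [h, if_false]; exact (hfac i _).2
    have hZa : ∀ G, Z (G ∪ A a) = Z G := by
      intro G
      apply Finset.prod_congr rfl
      intro i hi
      have hd : Disjoint (A a) (A i) := by
        have := (Finset.mem_filter.1 hi).2
        simpa using this
      have : A i ⊆ G ∪ A a ↔ A i ⊆ G := by
        constructor
        · intro h y hy
          rcases Finset.mem_union.1 (h hy) with h | h
          · exact h
          · exact absurd hy (Finset.disjoint_left.1 hd h)
        · intro h; exact h.trans Finset.subset_union_left
      simp [this]
    have hE : EE U p (fun G => ∏ i ∈ insert a s, (if A i ⊆ G then 1 - x else 1))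
        = EE U p W - x * (p ^ (A a).card * EE U p (fun G => W (G ∪ A a))) := by
      rw [← EE_subset U p (A a) hAa, ← EE_smul, ← EE_sub']
      apply EE_congr
      intro G _
      rw [Finset.prod_insert ha]
      split_ifs <;> simp [hW] <;> ring
    set σ : ℝ := ∑ j ∈ N, p ^ (A j \ A a).card with hσ
    have hEW0 : 0 ≤ EE U p W := EE_nonneg U p hp0 hp1 _ (fun G _ => hW0 G)
    have hlow : (1 - x * σ) * EE U p Z ≤ EE U p (fun G => W (G ∪ A a)) := by
      have h1 : ∀ G, G ⊆ U → Z G - x * ∑ j ∈ N, (if A j \ A a ⊆ G then Z G else 0) ≤ W (G ∪ A a) := by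
        intro G _
        rw [hWs, hZa]
        have h2 := one_sub_sum_le_prod' N (fun j => if A j \ A a ⊆ G then x else 0)
          (fun j _ => by split_ifs <;> constructor <;> linarith)
        have h3 : ∏ i ∈ N, (if A i ⊆ G ∪ A a then 1 - x else 1)
            = ∏ i ∈ N, (1 - if A i \ A a ⊆ G then x else 0) := by
          apply Finset.prod_congr rfl
          intro i _
          have : A i ⊆ G ∪ A a ↔ A i \ A a ⊆ G := by
            rw [Finset.union_comm]; exact sdiff_le_iff.symm
          simp only [this]; split_ifs <;> simp
        rw [h3]
        refine le_trans (le_of_eq ?_) (mul_le_mul_of_nonneg_right h2 (hZ0 G))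
        rw [sub_mul, one_mul, Finset.mul_sum, Finset.sum_mul]
        congr 1
        apply Finset.sum_congr rfl
        intro j _; split_ifs <;> simp
      have h2 := EE_mono U p hp0 hp1 _ _ h1
      rw [EE_sub', EE_smul, EE_sum] at h2
      refine le_trans ?_ h2
      have h3 : ∑ j ∈ N, EE U p (fun G => if A j \ A a ⊆ G then Z G else 0) ≤ σ * EE U p Z := by
        rw [hσ, Finset.sum_mul]
        apply Finset.sum_le_sum
        intro j hj
        have hjs : j ∈ s := (Finset.mem_filter.1 hj).1
        rw [EE_subset U p _ (Finset.sdiff_subset.trans (hAs j hjs))]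
        apply mul_le_mul_of_nonneg_left _ (by positivity)
        exact EE_mono U p hp0 hp1 _ _ (fun G _ => hZmono G _)
      nlinarith
    have hlow2 : (1 - x * σ) * EE U p W ≤ EE U p (fun G => W (G ∪ A a)) := by
      rcases le_or_gt 0 (1 - x * σ) with h | h
      · exact le_trans (mul_le_mul_of_nonneg_left
          (EE_mono U p hp0 hp1 _ _ (fun G _ => hWZ G)) h) hlow
      · exact le_trans (by nlinarith) (EE_nonneg U p hp0 hp1 _ (fun G _ => hW0 _))
    set τ : ℝ := p ^ (A a).card * σ with hτ
    have hτ' : τ = ∑ j ∈ s, if a ≠ j ∧ ¬ Disjoint (A a) (A j) then p ^ (A a ∪ A j).card else 0 := by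
      rw [hτ, hσ, Finset.mul_sum, hN, Finset.sum_filter]
      apply Finset.sum_congr rfl
      intro j hj
      have : a ≠ j := fun h => ha (h ▸ hj)
      simp only [this, ne_eq, not_false_eq_true, true_and]
      split_ifs
      · rfl
      · rw [← pow_add, ← Finset.union_sdiff_self_eq_union, Finset.card_union_of_disjoint
          Finset.disjoint_sdiff]
    have hstep : EE U p (fun G => ∏ i ∈ insert a s, (if A i ⊆ G then 1 - x else 1))
        ≤ EE U p W * Real.exp (-x * p ^ (A a).card + x ^ 2 * τ) := by
      rw [hE]
      have h1 : -x * p ^ (A a).card + x ^ 2 * τ + 1 ≤ Real.exp (-x * p ^ (A a).card + x ^ 2 * τ) :=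
        Real.add_one_le_exp _
      have h2 : x * p ^ (A a).card * ((1 - x * σ) * EE U p W)
          ≤ x * p ^ (A a).card * EE U p (fun G => W (G ∪ A a)) :=
        mul_le_mul_of_nonneg_left hlow2 (by positivity)
      have h3 := mul_le_mul_of_nonneg_left h1 hEW0
      rw [hτ] at *
      nlinarith
    refine hstep.trans ((mul_le_mul_of_nonneg_right ih (Real.exp_nonneg _)).trans ?_)
    rw [← Real.exp_add]
    apply Real.exp_le_exp.2
    rw [Finset.sum_insert ha, Finset.sum_insert ha, Finset.sum_insert ha]
    have h5 : ∑ i ∈ s, ∑ j ∈ s, (if i ≠ j ∧ ¬ Disjoint (A i) (A j) then p ^ (A i ∪ A j).card else 0)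
      ≤ ∑ i ∈ s, ∑ j ∈ insert a s,
        (if i ≠ j ∧ ¬ Disjoint (A i) (A j) then p ^ (A i ∪ A j).card else 0) := by
      apply Finset.sum_le_sum
      intro i _
      apply Finset.sum_le_sum_of_subset_of_nonneg (Finset.subset_insert _ _)
      intros; split_ifs <;> positivity
    rw [← hτ']
    have h6 : (0:ℝ) ≤ if a ≠ a ∧ ¬ Disjoint (A a) (A a) then p ^ (A a ∪ A a).card else 0 := by
      simp
    nlinarith [sq_nonneg x]

end general


section comb

/-- Partitions of `V` into `k` sets of size `r`. -/
noncomputable def PT {α : Type*} [DecidableEq α] (r : ℕ) (V : Finset α) (k : ℕ) :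
    Finset (Finset (Finset α)) :=
  ((Finset.powersetCard r V).powerset).filter
    (fun P => P.card = k ∧ (∀ S ∈ P, ∀ T ∈ P, S ≠ T → S ∩ T = ∅) ∧ (∀ v ∈ V, ∃ S ∈ P, v ∈ S))

lemma mem_PT {α : Type*} [DecidableEq α] {r : ℕ} {V : Finset α} {k : ℕ} {P : Finset (Finset α)} :
    P ∈ PT r V k ↔ P ⊆ Finset.powersetCard r V ∧ P.card = k ∧
      (∀ S ∈ P, ∀ T ∈ P, S ≠ T → S ∩ T = ∅) ∧ (∀ v ∈ V, ∃ S ∈ P, v ∈ S) := by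
  unfold PT
  rw [Finset.mem_filter, Finset.mem_powerset]

lemma PT_card {α : Type*} [DecidableEq α] (r : ℕ) (k : ℕ) : ∀ (V : Finset α), V.card = r * k →
    (PT r V k).card * (r.factorial ^ k * k.factorial) ≤ (r * k).factorial := by
  induction k with
  | zero =>
    intro V hV
    have : PT r V 0 ⊆ {∅} := by
      intro P hP
      have := (Finset.mem_filter.1 hP).2.1
      simpa using this
    have := Finset.card_le_card this
    simpa using this
  | succ k ih =>
    intro V hV
    have h1 : (k + 1) * (PT r V (k+1)).card = ((PT r V (k+1)).sigma (fun P => P)).card := by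
      rw [Finset.card_sigma, Finset.sum_congr rfl (fun P hP => (Finset.mem_filter.1 hP).2.1)]
      simp [mul_comm]
    have h2 : ((PT r V (k+1)).sigma (fun P => P)).card ≤
        ((Finset.powersetCard r V).sigma (fun S => PT r (V \ S) k)).card := by
      apply Finset.card_le_card_of_injOn
        (fun q : (_ : Finset (Finset α)) × Finset α => (⟨q.2, q.1.erase q.2⟩ : (_ : Finset α) × Finset (Finset α)))
      · rintro ⟨P, S⟩ hq
        simp only [Finset.coe_sigma, Set.mem_sigma_iff, Finset.mem_coe] at hq ⊢
        obtain ⟨hP, hS⟩ := hq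
        obtain ⟨hP1, hP2, hP3, hP4⟩ := Finset.mem_filter.1 hP
        rw [Finset.mem_powerset] at hP1
        refine ⟨hP1 hS, Finset.mem_filter.2 ⟨Finset.mem_powerset.2 ?_, ?_, ?_, ?_⟩⟩
        · intro T hT
          obtain ⟨hT1, hT2⟩ := Finset.mem_erase.1 hT
          have h3 := Finset.mem_powersetCard.1 (hP1 hT2)
          refine Finset.mem_powersetCard.2 ⟨?_, h3.2⟩
          intro v hv
          refine Finset.mem_sdiff.2 ⟨h3.1 hv, fun hvS => ?_⟩
          have := hP3 T hT2 S hS hT1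
          have hh : v ∈ T ∩ S := Finset.mem_inter.2 ⟨hv, hvS⟩
          rw [this] at hh; simp at hh
        · rw [Finset.card_erase_of_mem hS, hP2]; rfl
        · intro S1 h1 S2 h2 h3
          exact hP3 S1 (Finset.mem_of_mem_erase h1) S2 (Finset.mem_of_mem_erase h2) h3
        · intro v hv
          obtain ⟨hv1, hv2⟩ := Finset.mem_sdiff.1 hv
          obtain ⟨T, hT, hvT⟩ := hP4 v hv1
          exact ⟨T, Finset.mem_erase.2 ⟨fun h => hv2 (h ▸ hvT), hT⟩, hvT⟩
      · rintro ⟨P, S⟩ hq ⟨P', S'⟩ hq' heq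
        simp only [Finset.coe_sigma, Set.mem_sigma_iff, Finset.mem_coe] at hq hq'
        simp only [Sigma.mk.injEq, heq_eq_eq] at heq
        obtain ⟨rfl, h⟩ := heq
        have : P = P' := by
          rw [← Finset.insert_erase hq.2, h, Finset.insert_erase hq'.2]
        rw [this]
    have h3 : ((Finset.powersetCard r V).sigma (fun S => PT r (V \ S) k)).card *
        (r.factorial ^ k * k.factorial) ≤ (r * (k+1)).choose r * (r * k).factorial := by
      rw [Finset.card_sigma, Finset.sum_mul]
      refine le_trans (Finset.sum_le_card_nsmul _ _ ((r * k).factorial) ?_) ?_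
      · intro S hS
        apply ih
        obtain ⟨hS1, hS2⟩ := Finset.mem_powersetCard.1 hS
        rw [Finset.card_sdiff_of_subset hS1, hV, hS2]
        rw [mul_add, mul_one, Nat.add_sub_cancel]
      · rw [Finset.card_powersetCard, hV, smul_eq_mul]
    have h4 : (r * (k+1)).choose r * r.factorial * (r * k).factorial = (r * (k+1)).factorial := by
      have := Nat.choose_mul_factorial_mul_factorial (n := r * (k+1)) (k := r) (by nlinarith)
      rw [show r * (k+1) - r = r * k by rw [mul_add, mul_one, Nat.add_sub_cancel]] at this
      exact this
    calc (PT r V (k+1)).card * (r.factorial ^ (k+1) * (k+1).factorial)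
        = ((k + 1) * (PT r V (k+1)).card) * (r.factorial ^ k * k.factorial) * r.factorial := by
          rw [Nat.factorial_succ, pow_succ]; ring
      _ ≤ ((Finset.powersetCard r V).sigma (fun S => PT r (V \ S) k)).card *
        (r.factorial ^ k * k.factorial) * r.factorial := by
          rw [h1]; gcongr
      _ ≤ (r * (k+1)).choose r * (r * k).factorial * r.factorial := by gcongr
      _ = _ := by rw [← h4]; ring

/-- The set of all potential factors. -/
noncomputable def Fac (n r : ℕ) : Finset (Finset (Finset (Fin n))) :=
  PT r (Finset.univ : Finset (Fin n)) (n / r)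

/-- The pairs covered by `P`. -/
def PE {n : ℕ} (P : Finset (Finset (Fin n))) : Finset (Finset (Fin n)) :=
  P.biUnion (fun S => Finset.powersetCard 2 S)

lemma mem_PE {n : ℕ} {P : Finset (Finset (Fin n))} {e : Finset (Fin n)} :
    e ∈ PE P ↔ ∃ S ∈ P, e ⊆ S ∧ e.card = 2 := by
  simp [PE, Finset.mem_powersetCard]

lemma Fac_card (n r : ℕ) (hrn : r ∣ n) :
    (Fac n r).card * (r.factorial ^ (n / r) * (n / r).factorial) ≤ n.factorial := by
  have h : r * (n / r) = n := Nat.mul_div_cancel' hrn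
  have := PT_card r (n / r) (Finset.univ : Finset (Fin n)) (by simp [h])
  rw [h] at this
  exact this

lemma pairs_sub {n : ℕ} (S : Finset (Fin n)) : Finset.powersetCard 2 S ⊆ pairsUniv n :=
  Finset.powersetCard_mono (Finset.subset_univ S)

lemma PE_sub {n : ℕ} (P : Finset (Finset (Fin n))) : PE P ⊆ pairsUniv n := by
  intro e he
  obtain ⟨S, _, h, h2⟩ := mem_PE.1 he
  exact pairs_sub S (Finset.mem_powersetCard.2 ⟨h, h2⟩)

lemma pairs_inter {n : ℕ} (S T : Finset (Fin n)) :
    Finset.powersetCard 2 S ∩ Finset.powersetCard 2 T = Finset.powersetCard 2 (S ∩ T) := by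
  ext e; simp only [Finset.mem_inter, Finset.mem_powersetCard, Finset.subset_inter_iff]; tauto

lemma PE_card {n r : ℕ} {P : Finset (Finset (Fin n))} (hP : P ∈ Fac n r) :
    (PE P).card = (n / r) * r.choose 2 := by
  obtain ⟨hP1, hP2, hP3, hP4⟩ := mem_PT.1 hP
  unfold PE
  rw [Finset.card_biUnion]
  · rw [Finset.sum_congr rfl (g := fun _ => r.choose 2), Finset.sum_const, hP2, smul_eq_mul]
    intro S hS
    rw [Finset.card_powersetCard, (Finset.mem_powersetCard.1 (hP1 hS)).2]
  · intro S hS T hT hST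
    change Disjoint (Finset.powersetCard 2 S) (Finset.powersetCard 2 T)
    rw [Finset.disjoint_iff_inter_eq_empty, pairs_inter, hP3 S hS T hT hST]
    rfl

lemma numFactors_eq (n r : ℕ) (G : Finset (Finset (Fin n))) :
    (numFactors n r G : ℝ) = ∑ P ∈ Fac n r, if PE P ⊆ G then 1 else 0 := by
  unfold numFactors
  rw [Finset.sum_boole]
  congr 2
  ext P
  simp only [Fac, Finset.mem_filter, mem_PT, PE, Finset.biUnion_subset, Finset.mem_univ, true_imp_iff,
    Finset.mem_powerset]
  tauto

lemma E_numFactors (n r : ℕ) (p : ℝ) (g : Finset (Finset (Fin n)) → ℝ) :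
    EE (pairsUniv n) p (fun G => (numFactors n r G : ℝ) * g G) =
      ∑ P ∈ Fac n r, p ^ ((n / r) * r.choose 2) * EE (pairsUniv n) p (fun G => g (G ∪ PE P)) := by
  have : ∀ P ∈ Fac n r, p ^ ((n / r) * r.choose 2) * EE (pairsUniv n) p (fun G => g (G ∪ PE P))
      = EE (pairsUniv n) p (fun G => if PE P ⊆ G then g G else 0) := by
    intro P hP
    rw [EE_subset _ _ _ (PE_sub P), PE_card hP]
  rw [Finset.sum_congr rfl this, ← EE_sum]
  apply EE_congr
  intro G _
  rw [numFactors_eq, Finset.sum_mul]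
  apply Finset.sum_congr rfl
  intro P _; split_ifs <;> simp

lemma pow_clique (n r : ℕ) (y : ℝ) (G : Finset (Finset (Fin n))) :
    y ^ (cliqueHyp n r G).card = ∏ S ∈ Finset.powersetCard r (Finset.univ : Finset (Fin n)),
      if Finset.powersetCard 2 S ⊆ G then y else 1 := by
  unfold cliqueHyp
  rw [← Finset.prod_filter, Finset.prod_const]

lemma pow_clique_planted {n r : ℕ} (y : ℝ) (G P : Finset (Finset (Fin n))) (hP : P ∈ Fac n r) :
    y ^ (cliqueHyp n r (G ∪ PE P)).card = y ^ (n / r) *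
      ∏ S ∈ Finset.powersetCard r (Finset.univ : Finset (Fin n)) \ P,
      if Finset.powersetCard 2 S \ PE P ⊆ G then y else 1 := by
  obtain ⟨hP1, hP2, hP3, hP4⟩ := mem_PT.1 hP
  rw [pow_clique, ← Finset.prod_sdiff hP1, mul_comm]
  have : ∀ S : Finset (Fin n), Finset.powersetCard 2 S ⊆ G ∪ PE P ↔
      Finset.powersetCard 2 S \ PE P ⊆ G := by
    intro S
    rw [Finset.union_comm]; exact sdiff_le_iff.symm
  congr 1
  · rw [Finset.prod_congr rfl (g := fun _ => y), Finset.prod_const, hP2]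
    intro S hS
    rw [if_pos]
    refine subset_trans ?_ Finset.subset_union_right
    exact Finset.subset_biUnion_of_mem (fun S => Finset.powersetCard 2 S) hS
  · apply Finset.prod_congr rfl
    intro S _
    simp only [this]

/-- The overlap sum. -/
noncomputable def DD (n r : ℕ) (p : ℝ) : ℝ :=
  ∑ j ∈ Finset.Ico 2 r, (r.choose j : ℝ) * (n : ℝ) ^ (r - j) * p ^ (r.choose 2 - j.choose 2)

lemma card_inter_count {n r : ℕ} (S : Finset (Fin n)) (hS : S.card = r) (j : ℕ) :
    ((Finset.powersetCard r (Finset.univ : Finset (Fin n))).filter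
      (fun T => (S ∩ T).card = j)).card ≤ r.choose j * n ^ (r - j) := by
  have h1 : ((Finset.powersetCard r (Finset.univ : Finset (Fin n))).filter
      (fun T => (S ∩ T).card = j)).card ≤
      (Finset.powersetCard j S ×ˢ Finset.powersetCard (r - j) (Finset.univ : Finset (Fin n))).card := by
    apply Finset.card_le_card_of_injOn (fun T => (S ∩ T, T \ S))
    · intro T hT
      simp only [Finset.coe_filter, Set.mem_ofPred_eq, Finset.mem_powersetCard] at hT
      simp only [Finset.coe_product, Set.mem_prod, Finset.mem_coe, Finset.mem_powersetCard]
      refine ⟨⟨Finset.inter_subset_left, hT.2⟩, Finset.subset_univ _, ?_⟩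
      rw [Finset.card_sdiff, hT.1.2, hT.2]
    · intro T _ T' _ h
      simp only [Prod.mk.injEq] at h
      rw [← Finset.sdiff_union_inter T S, ← Finset.sdiff_union_inter T' S, h.2,
        Finset.inter_comm T, Finset.inter_comm T', h.1]
  refine h1.trans ?_
  rw [Finset.card_product, Finset.card_powersetCard, Finset.card_powersetCard, hS, Finset.card_univ,
    Fintype.card_fin]
  exact Nat.mul_le_mul_left _ (Nat.choose_le_pow _ _)

lemma overlap_sum {n r : ℕ} (p : ℝ) (hp0 : 0 < p) (S : Finset (Fin n)) (hS : S.card = r) :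
    ∑ T ∈ Finset.powersetCard r (Finset.univ : Finset (Fin n)),
      (if S ≠ T ∧ ¬ Disjoint (Finset.powersetCard 2 S) (Finset.powersetCard 2 T) then
        p ^ (Finset.powersetCard 2 S ∪ Finset.powersetCard 2 T).card else 0)
      ≤ p ^ r.choose 2 * DD n r p := by
  have h1 : ∀ T ∈ Finset.powersetCard r (Finset.univ : Finset (Fin n)),
      (if S ≠ T ∧ ¬ Disjoint (Finset.powersetCard 2 S) (Finset.powersetCard 2 T) then
        p ^ (Finset.powersetCard 2 S ∪ Finset.powersetCard 2 T).card else 0)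
      ≤ ∑ j ∈ Finset.Ico 2 r, if (S ∩ T).card = j then
        p ^ r.choose 2 * p ^ (r.choose 2 - j.choose 2) else 0 := by
    intro T hT
    have hTc := (Finset.mem_powersetCard.1 hT).2
    split_ifs with h
    · obtain ⟨hne, hd⟩ := h
      rw [Finset.disjoint_iff_inter_eq_empty, pairs_inter, Finset.powersetCard_eq_empty, not_lt] at hd
      have hlt : (S ∩ T).card < r := by
        rcases lt_or_ge (S ∩ T).card r with h | h
        · exact h
        · exfalso; apply hne
          have e1 := Finset.eq_of_subset_of_card_le (Finset.inter_subset_left (s₁ := S) (s₂ := T)) (by omega)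
          have e2 := Finset.eq_of_subset_of_card_le (Finset.inter_subset_right (s₁ := S) (s₂ := T)) (by omega)
          rw [← e1]; exact e2
      rw [Finset.sum_ite_eq, if_pos (Finset.mem_Ico.2 ⟨hd, hlt⟩)]
      rw [← pow_add]
      apply le_of_eq
      congr 1
      have h3 := Finset.card_union_add_card_inter (Finset.powersetCard 2 S) (Finset.powersetCard 2 T)
      rw [pairs_inter, Finset.card_powersetCard, Finset.card_powersetCard, Finset.card_powersetCard,
        hS, hTc] at h3
      have h4 : (S ∩ T).card.choose 2 ≤ r.choose 2 := Nat.choose_le_choose 2 hlt.le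
      omega
    · apply Finset.sum_nonneg
      intros; split_ifs <;> positivity
  refine (Finset.sum_le_sum h1).trans ?_
  rw [Finset.sum_comm, DD, Finset.mul_sum]
  apply Finset.sum_le_sum
  intro j _
  rw [← Finset.sum_filter, Finset.sum_const, nsmul_eq_mul]
  have h2 : (((Finset.powersetCard r (Finset.univ : Finset (Fin n))).filter
      (fun T => (S ∩ T).card = j)).card : ℝ) ≤ r.choose j * (n:ℝ) ^ (r - j) := by
    exact_mod_cast card_inter_count S hS j
  calc _ ≤ (r.choose j * (n:ℝ) ^ (r - j)) * (p ^ r.choose 2 * p ^ (r.choose 2 - j.choose 2)) := by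
        gcongr
    _ = _ := by ring

end comb


section prob

lemma E_clique_sq (n r : ℕ) (p : ℝ) (hp0 : 0 < p) (hp1 : p < 1) :
    EE (pairsUniv n) p (fun G => ((cliqueHyp n r G).card : ℝ)) = muR n r p ∧
    EE (pairsUniv n) p (fun G => ((cliqueHyp n r G).card : ℝ) ^ 2) ≤
      muR n r p ^ 2 + (muR n r p + muR n r p * DD n r p) := by
  set Q := Finset.powersetCard r (Finset.univ : Finset (Fin n)) with hQ
  have hQc : Q.card = n.choose r := by simp [hQ]
  have hX : ∀ G : Finset (Finset (Fin n)), ((cliqueHyp n r G).card : ℝ)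
      = ∑ S ∈ Q, if Finset.powersetCard 2 S ⊆ G then 1 else 0 := by
    intro G
    rw [Finset.sum_boole]; rfl
  have hE : ∀ A ⊆ pairsUniv n, EE (pairsUniv n) p (fun G => if A ⊆ G then 1 else 0) = p ^ A.card := by
    intro A hA
    rw [EE_subset _ _ _ hA, EE_const, mul_one]
  have hSc : ∀ S ∈ Q, (Finset.powersetCard 2 S).card = r.choose 2 := by
    intro S hS
    rw [Finset.card_powersetCard, (Finset.mem_powersetCard.1 hS).2]
  constructor
  · simp_rw [hX]
    rw [EE_sum, Finset.sum_congr rfl (g := fun _ => p ^ r.choose 2), Finset.sum_const, hQc, muR,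
      nsmul_eq_mul]
    intro S hS
    rw [hE _ (pairs_sub S), hSc S hS]
  · have h1 : ∀ G : Finset (Finset (Fin n)), ((cliqueHyp n r G).card : ℝ) ^ 2
      = ∑ S ∈ Q, ∑ T ∈ Q, if Finset.powersetCard 2 S ∪ Finset.powersetCard 2 T ⊆ G then 1 else 0 := by
      intro G
      rw [hX, sq, Finset.sum_mul_sum]
      apply Finset.sum_congr rfl; intro S _
      apply Finset.sum_congr rfl; intro T _
      by_cases h1 : Finset.powersetCard 2 S ⊆ G <;> by_cases h2 : Finset.powersetCard 2 T ⊆ G <;>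
        simp [Finset.union_subset_iff, h1, h2]
    simp_rw [h1]
    rw [EE_sum]
    have h2 : ∀ S ∈ Q, EE (pairsUniv n) p (fun G => ∑ T ∈ Q,
        if Finset.powersetCard 2 S ∪ Finset.powersetCard 2 T ⊆ G then 1 else 0) ≤
        p ^ r.choose 2 * muR n r p + (p ^ r.choose 2 + p ^ r.choose 2 * DD n r p) := by
      intro S hS
      rw [EE_sum]
      have h3 : ∀ T ∈ Q, EE (pairsUniv n) p (fun G =>
        if Finset.powersetCard 2 S ∪ Finset.powersetCard 2 T ⊆ G then 1 else 0) ≤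
        p ^ r.choose 2 * p ^ r.choose 2 + ((if S = T then p ^ r.choose 2 else 0) +
        (if S ≠ T ∧ ¬ Disjoint (Finset.powersetCard 2 S) (Finset.powersetCard 2 T) then
        p ^ (Finset.powersetCard 2 S ∪ Finset.powersetCard 2 T).card else 0)) := by
        intro T hT
        rw [hE _ (Finset.union_subset (pairs_sub S) (pairs_sub T))]
        by_cases hST : S = T
        · subst hST
          simp only [Finset.union_self, hSc S hS]
          simp; positivity
        · by_cases hd : Disjoint (Finset.powersetCard 2 S) (Finset.powersetCard 2 T)
          · rw [Finset.card_union_of_disjoint hd, hSc S hS, hSc T hT]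
            simp [hST, hd, pow_add]
          · simp only [ne_eq, hST, not_false_eq_true, hd, and_self, if_true, if_false, zero_add]
            have : 0 < p ^ r.choose 2 * p ^ r.choose 2 := by positivity
            linarith
      refine (Finset.sum_le_sum h3).trans ?_
      rw [Finset.sum_add_distrib, Finset.sum_add_distrib, Finset.sum_const, hQc, Finset.sum_ite_eq,
        if_pos hS, nsmul_eq_mul]
      have h4 := overlap_sum p hp0 S (Finset.mem_powersetCard.1 hS).2
      have h5 : (n.choose r : ℝ) * (p ^ r.choose 2 * p ^ r.choose 2) = p ^ r.choose 2 * muR n r p := by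
        unfold muR; ring
      rw [h5]
      linarith
    refine (Finset.sum_le_sum h2).trans ?_
    rw [Finset.sum_const, hQc, nsmul_eq_mul]
    apply le_of_eq
    unfold muR; ring

lemma cheb (n r : ℕ) (p d : ℝ) (hp0 : 0 < p) (hp1 : p < 1) (hd : 0 < d) :
    EE (pairsUniv n) p (fun G => if muR n r p + d < ((cliqueHyp n r G).card : ℝ) then 1 else 0) ≤
      (muR n r p + muR n r p * DD n r p) / d ^ 2 := by
  obtain ⟨h1, h2⟩ := E_clique_sq n r p hp0 hp1
  rw [le_div_iff₀ (by positivity), mul_comm, ← EE_smul]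
  have h3 : EE (pairsUniv n) p (fun G => ((cliqueHyp n r G).card : ℝ) ^ 2
      - (2 * muR n r p) * ((cliqueHyp n r G).card : ℝ) + muR n r p ^ 2) ≤
      muR n r p + muR n r p * DD n r p := by
    rw [EE_add, EE_sub', EE_smul, EE_const, h1]
    nlinarith
  refine le_trans (EE_mono _ _ hp0 hp1 _ _ ?_) h3
  intro G _
  split_ifs with h
  · nlinarith
  · nlinarith [sq_nonneg (((cliqueHyp n r G).card : ℝ) - muR n r p)]

lemma planted_general {n r : ℕ} (p x : ℝ) (hp0 : 0 < p) (hp1 : p < 1) (hx0 : 0 ≤ x) (hx1 : x ≤ 1)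
    (P : Finset (Finset (Fin n))) (hP : P ∈ Fac n r) :
    EE (pairsUniv n) p (fun G => (1 - x) ^ (cliqueHyp n r (G ∪ PE P)).card) ≤
      (1 - x) ^ (n / r) * Real.exp (-x * (muR n r p - (n / r : ℕ) * p ^ r.choose 2) +
        x ^ 2 * (muR n r p * DD n r p)) := by
  set Q := Finset.powersetCard r (Finset.univ : Finset (Fin n)) with hQ
  have hQc : Q.card = n.choose r := by simp [hQ]
  obtain ⟨hP1, hP2, hP3, hP4⟩ := mem_PT.1 hP
  have h0 : (0:ℝ) ≤ 1 - x := by linarith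
  have h1 : EE (pairsUniv n) p (fun G => (1 - x) ^ (cliqueHyp n r (G ∪ PE P)).card) ≤
      (1 - x) ^ (n / r) * EE (pairsUniv n) p (fun G => ∏ S ∈ Q \ P,
        if Finset.powersetCard 2 S ⊆ G then 1 - x else 1) := by
    rw [← EE_smul]
    apply EE_mono _ _ hp0 hp1
    intro G _
    rw [pow_clique_planted _ _ _ hP]
    apply mul_le_mul_of_nonneg_left _ (by positivity)
    apply Finset.prod_le_prod
    · intro i _; split_ifs <;> linarith
    · intro S _
      by_cases h : Finset.powersetCard 2 S ⊆ G
      · have : Finset.powersetCard 2 S \ PE P ⊆ G := Finset.sdiff_subset.trans h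
        simp [h, this]
      · simp only [h, if_false]; split_ifs <;> linarith
  refine h1.trans (mul_le_mul_of_nonneg_left ?_ (by positivity))
  refine (janson (pairsUniv n) p x hp0 hp1 hx0 hx1 (fun S => Finset.powersetCard 2 S) (Q \ P)
    (fun S _ => pairs_sub S)).trans ?_
  apply Real.exp_le_exp.2
  have hs : ∑ S ∈ Q \ P, p ^ (Finset.powersetCard 2 S).card = muR n r p - (n / r : ℕ) * p ^ r.choose 2 := by
    rw [Finset.sum_congr rfl (g := fun _ => p ^ r.choose 2), Finset.sum_const, nsmul_eq_mul,
      Finset.card_sdiff_of_subset hP1, Nat.cast_sub (Finset.card_le_card hP1), hQc, hP2, muR, sub_mul]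
    intro S hS
    rw [Finset.card_powersetCard, (Finset.mem_powersetCard.1 (Finset.mem_sdiff.1 hS).1).2]
  rw [hs]
  have hd : ∑ S ∈ Q \ P, ∑ T ∈ Q \ P,
      (if S ≠ T ∧ ¬ Disjoint (Finset.powersetCard 2 S) (Finset.powersetCard 2 T) then
        p ^ (Finset.powersetCard 2 S ∪ Finset.powersetCard 2 T).card else 0) ≤
      muR n r p * DD n r p := by
    calc _ ≤ ∑ S ∈ Q, p ^ r.choose 2 * DD n r p := by
          refine le_trans (Finset.sum_le_sum_of_subset_of_nonneg Finset.sdiff_subset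
            (fun S _ _ => Finset.sum_nonneg (fun T _ => by split_ifs <;> positivity))) ?_
          apply Finset.sum_le_sum
          intro S hS
          refine le_trans ?_ (overlap_sum p hp0 S (Finset.mem_powersetCard.1 hS).2)
          exact Finset.sum_le_sum_of_subset_of_nonneg Finset.sdiff_subset
            (fun T _ _ => by split_ifs <;> positivity)
      _ = _ := by
          rw [Finset.sum_const, hQc, nsmul_eq_mul, muR]; ring
  have := mul_le_mul_of_nonneg_left hd (sq_nonneg x)
  linarith

lemma part_unique {n r : ℕ} {P : Finset (Finset (Fin n))} (hP : P ∈ Fac n r) {S T : Finset (Fin n)}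
    (hS : S ∈ P) (hT : T ∈ P) {v : Fin n} (hvS : v ∈ S) (hvT : v ∈ T) : S = T := by
  by_contra h
  have h1 := (mem_PT.1 hP).2.2.1 S hS T hT h
  have h2 : v ∈ S ∩ T := Finset.mem_inter.2 ⟨hvS, hvT⟩
  rw [h1] at h2; simp at h2

lemma three_edge_sum {n : ℕ} (p : ℝ) (hp0 : 0 < p) (hp1 : p < 1)
    (P : Finset (Finset (Fin n))) (hP : P ∈ Fac n 3) (e : Finset (Fin n)) (he : e.card = 2)
    (heP : e ∉ PE P) :
    ∑ T ∈ Finset.powersetCard 3 (Finset.univ : Finset (Fin n)) \ P,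
      (if e ⊆ T then p ^ ((Finset.powersetCard 2 T \ PE P).card - 1) else 0) ≤ n * p ^ 2 + 4 * p := by
  obtain ⟨u, v, huv, rfl⟩ := Finset.card_eq_two.1 he
  obtain ⟨hP1, hP2, hP3, hP4⟩ := mem_PT.1 hP
  obtain ⟨Su, hSu, huS⟩ := hP4 u (Finset.mem_univ u)
  obtain ⟨Sv, hSv, hvS⟩ := hP4 v (Finset.mem_univ v)
  set I : Finset (Finset (Fin n)) := (Finset.univ : Finset (Fin n)).image (fun w => insert w {u, v}) with hI
  set R : Finset (Finset (Fin n)) := (Su.erase u ∪ Sv.erase v).image (fun w => insert w {u, v}) with hR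
  have hIc : (I.card : ℝ) ≤ n := by
    have := Finset.card_image_le (s := (Finset.univ : Finset (Fin n))) (f := fun w => insert w ({u, v} : Finset (Fin n)))
    simp only [Finset.card_univ, Fintype.card_fin] at this
    exact_mod_cast this
  have hRc : (R.card : ℝ) ≤ 4 := by
    have h1 : R.card ≤ (Su.erase u ∪ Sv.erase v).card := Finset.card_image_le
    have h2 := Finset.card_union_le (Su.erase u) (Sv.erase v)
    rw [Finset.card_erase_of_mem huS, Finset.card_erase_of_mem hvS,
      (Finset.mem_powersetCard.1 (hP1 hSu)).2, (Finset.mem_powersetCard.1 (hP1 hSv)).2] at h2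
    have : R.card ≤ 4 := by omega
    exact_mod_cast this
  have key : ∀ T ∈ Finset.powersetCard 3 (Finset.univ : Finset (Fin n)) \ P,
      (if {u, v} ⊆ T then p ^ ((Finset.powersetCard 2 T \ PE P).card - 1) else 0) ≤
      (if T ∈ I then p ^ 2 else 0) + (if T ∈ R then p else 0) := by
    intro T hT
    split_ifs with h1 h2 h3
    all_goals try positivity
    all_goals
      obtain ⟨hT1, hT2⟩ := Finset.mem_sdiff.1 hT
      obtain ⟨w, hw⟩ : ∃ w, T \ {u, v} = {w} := by
        apply Finset.card_eq_one.1
        rw [Finset.card_sdiff_of_subset h1, he, (Finset.mem_powersetCard.1 hT1).2]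
      have hTw : T = insert w {u, v} := by
        rw [← Finset.sdiff_union_of_subset h1, hw]; rfl
      have hwT : w ∉ ({u, v} : Finset (Fin n)) := by
        have : w ∈ T \ {u, v} := by rw [hw]; simp
        exact (Finset.mem_sdiff.1 this).2
      have hTI : T ∈ I := by
        rw [hI, hTw]; exact Finset.mem_image_of_mem _ (Finset.mem_univ w)
      have hwu : w ≠ u := by rintro rfl; simp at hwT
      have hwv : w ≠ v := by rintro rfl; simp at hwT
    · -- both: only need exponent at least one
      have h4 : 2 ≤ (Finset.powersetCard 2 T \ PE P).card := by
        by_cases h5 : ({u, w} : Finset (Fin n)) ∈ PE P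
        · have h6 : ({v, w} : Finset (Fin n)) ∉ PE P := by
            intro h6
            obtain ⟨S, hS, hS1, _⟩ := mem_PE.1 h5
            obtain ⟨S', hS', hS1', _⟩ := mem_PE.1 h6
            have : S = S' := part_unique hP hS hS' (v := w) (hS1 (by simp)) (hS1' (by simp))
            subst this
            apply heP
            refine mem_PE.2 ⟨S, hS, ?_, he⟩
            intro z hz
            rcases Finset.mem_insert.1 hz with rfl | hz
            · exact hS1 (by simp)
            · rw [Finset.mem_singleton] at hz; subst hz; exact hS1' (by simp)
          have h7 : ({{u, v}, {v, w}} : Finset (Finset (Fin n))) ⊆ Finset.powersetCard 2 T \ PE P := by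
            intro z hz
            simp only [Finset.mem_insert, Finset.mem_singleton] at hz
            rw [Finset.mem_sdiff, Finset.mem_powersetCard]
            rcases hz with rfl | rfl
            · exact ⟨⟨h1, he⟩, heP⟩
            · refine ⟨⟨?_, Finset.card_pair hwv.symm⟩, h6⟩
              rw [hTw]; intro z hz; simp at hz ⊢; tauto
          have h8 := Finset.card_le_card h7
          rwa [Finset.card_pair] at h8
          intro h
          have : w ∈ ({u, v} : Finset (Fin n)) := by rw [h]; simp
          exact hwT this
        · have h7 : ({{u, v}, {u, w}} : Finset (Finset (Fin n))) ⊆ Finset.powersetCard 2 T \ PE P := by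
            intro z hz
            simp only [Finset.mem_insert, Finset.mem_singleton] at hz
            rw [Finset.mem_sdiff, Finset.mem_powersetCard]
            rcases hz with rfl | rfl
            · exact ⟨⟨h1, he⟩, heP⟩
            · refine ⟨⟨?_, Finset.card_pair hwu.symm⟩, h5⟩
              rw [hTw]; intro z hz; simp at hz ⊢; tauto
          have h8 := Finset.card_le_card h7
          rwa [Finset.card_pair] at h8
          intro h
          have : w ∈ ({u, v} : Finset (Fin n)) := by rw [h]; simp
          exact hwT this
      have h5 : p ^ ((Finset.powersetCard 2 T \ PE P).card - 1) ≤ p ^ 1 :=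
        pow_le_pow_of_le_one hp0.le hp1.le (by omega)
      have : 0 < p ^ 2 := by positivity
      linarith
    · have h5 : ({u, w} : Finset (Fin n)) ∉ PE P := by
        intro h5
        obtain ⟨S, hS, hS1, _⟩ := mem_PE.1 h5
        have : S = Su := part_unique hP hS hSu (v := u) (hS1 (by simp)) huS
        subst this
        apply h3
        rw [hR, hTw]
        apply Finset.mem_image_of_mem
        exact Finset.mem_union_left _ (Finset.mem_erase.2 ⟨hwu, hS1 (by simp)⟩)
      have h6 : ({v, w} : Finset (Fin n)) ∉ PE P := by
        intro h5
        obtain ⟨S, hS, hS1, _⟩ := mem_PE.1 h5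
        have : S = Sv := part_unique hP hS hSv (v := v) (hS1 (by simp)) hvS
        subst this
        apply h3
        rw [hR, hTw]
        apply Finset.mem_image_of_mem
        exact Finset.mem_union_right _ (Finset.mem_erase.2 ⟨hwv, hS1 (by simp)⟩)
      have h7 : ({{u, v}, {u, w}, {v, w}} : Finset (Finset (Fin n))) ⊆ Finset.powersetCard 2 T \ PE P := by
        intro z hz
        simp only [Finset.mem_insert, Finset.mem_singleton] at hz
        rw [Finset.mem_sdiff, Finset.mem_powersetCard]
        rcases hz with rfl | rfl | rfl
        · exact ⟨⟨h1, he⟩, heP⟩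
        · refine ⟨⟨?_, Finset.card_pair hwu.symm⟩, h5⟩
          rw [hTw]; intro z hz; simp at hz ⊢; tauto
        · refine ⟨⟨?_, Finset.card_pair hwv.symm⟩, h6⟩
          rw [hTw]; intro z hz; simp at hz ⊢; tauto
      have h8 := Finset.card_le_card h7
      rw [Finset.card_insert_of_notMem, Finset.card_pair] at h8
      · have h5 : p ^ ((Finset.powersetCard 2 T \ PE P).card - 1) ≤ p ^ 2 :=
          pow_le_pow_of_le_one hp0.le hp1.le (by omega)
        linarith
      · intro h
        have : u ∈ ({v, w} : Finset (Fin n)) := by rw [← h]; simp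
        simp at this
        rcases this with h | h
        · exact huv h
        · exact hwu h.symm
      · intro h
        rw [Finset.mem_insert, Finset.mem_singleton] at h
        rcases h with h | h
        · have : w ∈ ({u, v} : Finset (Fin n)) := by rw [h]; simp
          exact hwT this
        · have : w ∈ ({u, v} : Finset (Fin n)) := by rw [h]; simp
          exact hwT this
    · exact absurd hTI (by assumption)
    · exact absurd hTI (by assumption)
  refine (Finset.sum_le_sum key).trans ?_
  rw [Finset.sum_add_distrib, ← Finset.sum_filter, ← Finset.sum_filter, Finset.sum_const, Finset.sum_const,
    nsmul_eq_mul, nsmul_eq_mul]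
  have g1 : (((Finset.powersetCard 3 (Finset.univ : Finset (Fin n)) \ P).filter (· ∈ I)).card : ℝ) ≤ n := by
    refine le_trans ?_ hIc
    exact_mod_cast Finset.card_le_card (fun T hT => (Finset.mem_filter.1 hT).2)
  have g2 : (((Finset.powersetCard 3 (Finset.univ : Finset (Fin n)) \ P).filter (· ∈ R)).card : ℝ) ≤ 4 := by
    refine le_trans ?_ hRc
    exact_mod_cast Finset.card_le_card (fun T hT => (Finset.mem_filter.1 hT).2)
  gcongr

end prob


section three

lemma three_double {n : ℕ} (p : ℝ) (hp0 : 0 < p) (hp1 : p < 1)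
    (P : Finset (Finset (Fin n))) (hP : P ∈ Fac n 3) (T : Finset (Fin n)) (hTc : T.card = 3) :
    ∑ T' ∈ Finset.powersetCard 3 (Finset.univ : Finset (Fin n)) \ P,
      (if T ≠ T' ∧ ¬ Disjoint (Finset.powersetCard 2 T \ PE P) (Finset.powersetCard 2 T' \ PE P) then
        p ^ ((Finset.powersetCard 2 T \ PE P) ∪ (Finset.powersetCard 2 T' \ PE P)).card else 0) ≤
    p ^ (Finset.powersetCard 2 T \ PE P).card * (3 * (n * p ^ 2 + 4 * p)) := by
  set A := Finset.powersetCard 2 T \ PE P with hA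
  have hAc : (A.card : ℝ) ≤ 3 := by
    have h1 : A.card ≤ (Finset.powersetCard 2 T).card := Finset.card_le_card Finset.sdiff_subset
    rw [Finset.card_powersetCard, hTc] at h1
    have : A.card ≤ 3 := by simpa using h1
    exact_mod_cast this
  have key : ∀ T' ∈ Finset.powersetCard 3 (Finset.univ : Finset (Fin n)) \ P,
      (if T ≠ T' ∧ ¬ Disjoint A (Finset.powersetCard 2 T' \ PE P) then
        p ^ (A ∪ (Finset.powersetCard 2 T' \ PE P)).card else 0) ≤
      ∑ e ∈ A, p ^ A.card * (if e ⊆ T' then p ^ ((Finset.powersetCard 2 T' \ PE P).card - 1) else 0) := by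
    intro T' hT'
    have hT'c : T'.card = 3 := (Finset.mem_powersetCard.1 (Finset.mem_sdiff.1 hT').1).2
    have hnn : ∀ e ∈ A, 0 ≤ p ^ A.card * (if e ⊆ T' then p ^ ((Finset.powersetCard 2 T' \ PE P).card - 1) else 0) := by
      intro e _
      split_ifs <;> positivity
    split_ifs with h
    · obtain ⟨hne, hd⟩ := h
      obtain ⟨e, he1, he2⟩ := Finset.not_disjoint_iff.1 hd
      refine le_trans ?_ (Finset.single_le_sum hnn he1)
      have heT' : e ⊆ T' := (Finset.mem_powersetCard.1 (Finset.mem_sdiff.1 he2).1).1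
      rw [if_pos heT', ← pow_add]
      apply pow_le_pow_of_le_one hp0.le hp1.le
      have h1 := Finset.card_union_add_card_inter A (Finset.powersetCard 2 T' \ PE P)
      have h2 : (A ∩ (Finset.powersetCard 2 T' \ PE P)).card ≤ 1 := by
        have h3 : A ∩ (Finset.powersetCard 2 T' \ PE P) ⊆ Finset.powersetCard 2 (T ∩ T') := by
          rw [← pairs_inter]
          exact Finset.inter_subset_inter Finset.sdiff_subset Finset.sdiff_subset
        have h4 := Finset.card_le_card h3
        rw [Finset.card_powersetCard] at h4
        have h5 : (T ∩ T').card ≤ 2 := by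
          by_contra hc
          apply hne
          have e1 := Finset.eq_of_subset_of_card_le (Finset.inter_subset_left (s₁ := T) (s₂ := T')) (by omega)
          have e2 := Finset.eq_of_subset_of_card_le (Finset.inter_subset_right (s₁ := T) (s₂ := T')) (by omega)
          rw [← e1]; exact e2
        have h6 : (T ∩ T').card.choose 2 ≤ Nat.choose 2 2 := Nat.choose_le_choose 2 h5
        simp at h6
        omega
      have h3 : 0 < (Finset.powersetCard 2 T' \ PE P).card := Finset.card_pos.2 ⟨e, he2⟩
      omega
    · exact Finset.sum_nonneg hnn
  refine (Finset.sum_le_sum key).trans ?_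
  rw [Finset.sum_comm]
  have h7 : ∀ e ∈ A, ∑ T' ∈ Finset.powersetCard 3 (Finset.univ : Finset (Fin n)) \ P,
      p ^ A.card * (if e ⊆ T' then p ^ ((Finset.powersetCard 2 T' \ PE P).card - 1) else 0) ≤
      p ^ A.card * (n * p ^ 2 + 4 * p) := by
    intro e he
    rw [← Finset.mul_sum]
    obtain ⟨he1, he2⟩ := Finset.mem_sdiff.1 he
    exact mul_le_mul_of_nonneg_left (three_edge_sum p hp0 hp1 P hP e
      (Finset.mem_powersetCard.1 he1).2 he2) (by positivity)
  refine (Finset.sum_le_sum h7).trans ?_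
  rw [Finset.sum_const, nsmul_eq_mul]
  have : 0 ≤ p ^ A.card * (n * p ^ 2 + 4 * p) := by positivity
  nlinarith

lemma three_count {n : ℕ} (P : Finset (Finset (Fin n))) (hP : P ∈ Fac n 3) (f : Finset (Fin n))
    (hf : f ∈ PE P) :
    (n : ℝ) - 3 ≤ (((Finset.powersetCard 3 (Finset.univ : Finset (Fin n)) \ P).filter
      (fun S => f ⊆ S)).card : ℝ) := by
  obtain ⟨S, hS, hfS, hfc⟩ := mem_PE.1 hf
  have hSc : S.card = 3 := (Finset.mem_powersetCard.1 ((mem_PT.1 hP).1 hS)).2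
  have h1 : (Finset.univ \ S).card ≤ ((Finset.powersetCard 3 (Finset.univ : Finset (Fin n)) \ P).filter
      (fun S => f ⊆ S)).card := by
    apply Finset.card_le_card_of_injOn (fun w => insert w f)
    · intro w hw
      have hwS : w ∉ S := (Finset.mem_sdiff.1 hw).2
      have hwf : w ∉ f := fun h => hwS (hfS h)
      simp only [Finset.coe_filter, Set.mem_ofPred_eq, Finset.mem_sdiff, Finset.mem_powersetCard]
      refine ⟨⟨⟨Finset.subset_univ _, by rw [Finset.card_insert_of_notMem hwf, hfc]⟩, fun h => ?_⟩,
        Finset.subset_insert _ _⟩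
      obtain ⟨v, hv⟩ : f.Nonempty := Finset.card_pos.1 (by omega)
      have := part_unique hP h hS (v := v) (Finset.mem_insert_of_mem hv) (hfS hv)
      apply hwS
      rw [← this]; exact Finset.mem_insert_self _ _
    · intro w hw w' hw' h
      have hwS : w ∉ S := (Finset.mem_sdiff.1 hw).2
      have hwf : w ∉ f := fun h => hwS (hfS h)
      simp only at h
      have : w ∈ insert w' f := by rw [← h]; exact Finset.mem_insert_self _ _
      rcases Finset.mem_insert.1 this with h | h
      · exact h
      · exact absurd h hwf
  rw [Finset.card_sdiff_of_subset (Finset.subset_univ S), hSc, Finset.card_univ, Fintype.card_fin] at h1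
  have : n ≤ ((Finset.powersetCard 3 (Finset.univ : Finset (Fin n)) \ P).filter
      (fun S => f ⊆ S)).card + 3 := by omega
  have : (n : ℝ) ≤ (((Finset.powersetCard 3 (Finset.univ : Finset (Fin n)) \ P).filter
      (fun S => f ⊆ S)).card : ℝ) + 3 := by exact_mod_cast this
  linarith

lemma three_mean {n : ℕ} (p : ℝ) (hp0 : 0 < p) (hp1 : p < 1)
    (P : Finset (Finset (Fin n))) (hP : P ∈ Fac n 3) :
    muR n 3 p - (n / 3 : ℕ) * p ^ 3 + 3 * (n / 3 : ℕ) * ((n : ℝ) - 3) * (p ^ 2 - p ^ 3) ≤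
    ∑ T ∈ Finset.powersetCard 3 (Finset.univ : Finset (Fin n)) \ P,
      p ^ (Finset.powersetCard 2 T \ PE P).card := by
  set Q := Finset.powersetCard 3 (Finset.univ : Finset (Fin n)) with hQ
  have hQc : Q.card = n.choose 3 := by simp [hQ]
  obtain ⟨hP1, hP2, hP3, hP4⟩ := mem_PT.1 hP
  have hpp : 0 ≤ p ^ 2 - p ^ 3 := by nlinarith [sq_nonneg p]
  have h1 : ∀ T ∈ Q \ P, p ^ 3 + (p ^ 2 - p ^ 3) * (∑ f ∈ PE P, if f ⊆ T then (1:ℝ) else 0) ≤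
      p ^ (Finset.powersetCard 2 T \ PE P).card := by
    intro T hT
    have hTc : T.card = 3 := (Finset.mem_powersetCard.1 (Finset.mem_sdiff.1 hT).1).2
    have h2 : (∑ f ∈ PE P, if f ⊆ T then (1:ℝ) else 0) = ((PE P ∩ Finset.powersetCard 2 T).card : ℝ) := by
      rw [Finset.sum_boole]
      congr 2
      ext f
      rw [Finset.mem_filter, Finset.mem_inter, Finset.mem_powersetCard]
      constructor
      · rintro ⟨h1, h2⟩
        obtain ⟨_, _, _, h3⟩ := mem_PE.1 h1
        exact ⟨h1, h2, h3⟩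
      · rintro ⟨h1, h2, _⟩
        exact ⟨h1, h2⟩
    rw [h2, Finset.card_sdiff, Finset.card_powersetCard, hTc]
    have h3 : (PE P ∩ Finset.powersetCard 2 T).card ≤ 3 := by
      have := Finset.card_le_card (Finset.inter_subset_right (s₁ := PE P) (s₂ := Finset.powersetCard 2 T))
      rw [Finset.card_powersetCard, hTc] at this
      simpa using this
    have h4 : Nat.choose 3 2 = 3 := by decide
    rw [h4]
    generalize (PE P ∩ Finset.powersetCard 2 T).card = c at h3
    interval_cases c
    · simp
    · simp
    · norm_num
      nlinarith [mul_nonneg hp0.le (sq_nonneg (1 - p))]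
    · norm_num
      nlinarith [mul_nonneg hp0.le (sq_nonneg (1 - p)), sq_nonneg (1 - p)]
  refine le_trans ?_ (Finset.sum_le_sum h1)
  rw [Finset.sum_add_distrib, Finset.sum_const, ← Finset.mul_sum, Finset.sum_comm, nsmul_eq_mul,
    Finset.card_sdiff_of_subset hP1, Nat.cast_sub (Finset.card_le_card hP1), hQc, hP2]
  have h5 : (3 * (n / 3 : ℕ) : ℝ) * ((n : ℝ) - 3) ≤
      ∑ f ∈ PE P, ∑ T ∈ Q \ P, (if f ⊆ T then (1:ℝ) else 0) := by
    have h6 : ∀ f ∈ PE P, (n : ℝ) - 3 ≤ ∑ T ∈ Q \ P, (if f ⊆ T then (1:ℝ) else 0) := by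
      intro f hf
      rw [Finset.sum_boole]
      exact three_count P hP f hf
    have h7 := Finset.card_nsmul_le_sum (PE P) _ _ h6
    rw [PE_card hP, nsmul_eq_mul] at h7
    refine le_trans (le_of_eq ?_) h7
    have h4 : Nat.choose 3 2 = 3 := by decide
    rw [h4]; push_cast; ring
  have h8 := mul_le_mul_of_nonneg_left h5 hpp
  have h4 : Nat.choose 3 2 = 3 := by decide
  unfold muR
  rw [h4]
  linarith

lemma planted_three {n : ℕ} (p x : ℝ) (hp0 : 0 < p) (hp1 : p < 1) (hx0 : 0 ≤ x) (hx1 : x ≤ 1)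
    (hxe : x * (3 * (n * p ^ 2 + 4 * p)) ≤ 1)
    (P : Finset (Finset (Fin n))) (hP : P ∈ Fac n 3) :
    EE (pairsUniv n) p (fun G => (1 - x) ^ (cliqueHyp n 3 (G ∪ PE P)).card) ≤
      (1 - x) ^ (n / 3) * Real.exp (-(x * (1 - x * (3 * (n * p ^ 2 + 4 * p))) *
        (muR n 3 p - (n / 3 : ℕ) * p ^ 3 + 3 * (n / 3 : ℕ) * ((n : ℝ) - 3) * (p ^ 2 - p ^ 3)))) := by
  set Q := Finset.powersetCard 3 (Finset.univ : Finset (Fin n)) with hQ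
  have h0 : (0:ℝ) ≤ 1 - x := by linarith
  have h1 : EE (pairsUniv n) p (fun G => (1 - x) ^ (cliqueHyp n 3 (G ∪ PE P)).card) =
      (1 - x) ^ (n / 3) * EE (pairsUniv n) p (fun G => ∏ S ∈ Q \ P,
        if Finset.powersetCard 2 S \ PE P ⊆ G then 1 - x else 1) := by
    rw [← EE_smul]
    apply EE_congr
    intro G _
    rw [pow_clique_planted _ _ _ hP]
  rw [h1]
  refine mul_le_mul_of_nonneg_left ?_ (by positivity)
  refine (janson (pairsUniv n) p x hp0 hp1 hx0 hx1 (fun S => Finset.powersetCard 2 S \ PE P) (Q \ P)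
    (fun S _ => Finset.sdiff_subset.trans (pairs_sub S))).trans ?_
  apply Real.exp_le_exp.2
  have hm := three_mean p hp0 hp1 P hP
  rw [← hQ] at hm
  set ε := 3 * (n * p ^ 2 + 4 * p) with hε
  set EY := ∑ T ∈ Q \ P, p ^ (Finset.powersetCard 2 T \ PE P).card with hEY
  have hd : ∑ S ∈ Q \ P, ∑ T ∈ Q \ P,
      (if S ≠ T ∧ ¬ Disjoint (Finset.powersetCard 2 S \ PE P) (Finset.powersetCard 2 T \ PE P) then
        p ^ ((Finset.powersetCard 2 S \ PE P) ∪ (Finset.powersetCard 2 T \ PE P)).card else 0) ≤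
      EY * ε := by
    rw [hEY, Finset.sum_mul]
    apply Finset.sum_le_sum
    intro S hS
    exact three_double p hp0 hp1 P hP S (Finset.mem_powersetCard.1 (Finset.mem_sdiff.1 hS).1).2
  have h2 := mul_le_mul_of_nonneg_left hd (sq_nonneg x)
  have h3 : 0 ≤ x * (1 - x * ε) := mul_nonneg hx0 (by linarith)
  have h4 := mul_le_mul_of_nonneg_left hm h3
  nlinarith

end three


section analytic

lemma fact_prod (r k : ℕ) :
    (r * k).factorial = r.factorial ^ k * ∏ j ∈ Finset.range k, (r * (j + 1)).choose r := by
  induction k with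
  | zero => simp
  | succ k ih =>
    have := Nat.choose_mul_factorial_mul_factorial (n := r * (k+1)) (k := r) (by nlinarith)
    rw [show r * (k+1) - r = r * k by rw [mul_add, mul_one, Nat.add_sub_cancel]] at this
    rw [Finset.prod_range_succ, ← this, ih, pow_succ]
    ring

lemma choose_ratio (r j k : ℕ) (hj : 1 ≤ j) (hjk : j ≤ k) :
    (r * j).choose r * k ^ r ≤ (r * k).choose r * j ^ r := by
  have h1 : (r * j).descFactorial r * k ^ r ≤ (r * k).descFactorial r * j ^ r := by
    rw [Nat.descFactorial_eq_prod_range, Nat.descFactorial_eq_prod_range]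
    have e1 : ∀ c : ℕ, c ^ r = ∏ _i ∈ Finset.range r, c := by intro c; simp
    rw [e1 k, e1 j, ← Finset.prod_mul_distrib, ← Finset.prod_mul_distrib]
    apply Finset.prod_le_prod' 
    intro i hi
    rw [Nat.sub_mul, Nat.sub_mul]
    have h2 : i * j ≤ i * k := Nat.mul_le_mul_left i hjk
    have h3 : r * j * k = r * k * j := by ring
    omega
  rw [Nat.descFactorial_eq_factorial_mul_choose, Nat.descFactorial_eq_factorial_mul_choose,
    mul_assoc, mul_assoc] at h1
  exact Nat.le_of_mul_le_mul_left h1 (Nat.factorial_pos r)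

lemma fact_two_pow (k : ℕ) (hk : 1 ≤ k) : k.factorial * 2 ^ k ≤ 2 * k ^ k := by
  induction k, hk using Nat.le_induction with
  | base => simp
  | succ k hk ih =>
    have h1 : 2 * k ^ k ≤ (k + 1) ^ k := by
      have hb : (1 : ℝ) + k * (1 / k) ≤ (1 + 1 / (k:ℝ)) ^ k := by
        apply one_add_mul_le_pow
        have : (0:ℝ) ≤ 1 / k := by positivity
        linarith
      have hk0 : (0:ℝ) < k := by exact_mod_cast hk
      have h2 : (1 : ℝ) + k * (1 / k) = 2 := by field_simp; norm_num
      rw [h2] at hb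
      have h3 : ((k:ℝ) + 1) ^ k = (1 + 1 / (k:ℝ)) ^ k * k ^ k := by
        rw [← mul_pow]; congr 1; field_simp
      have h4 : (2:ℝ) * k ^ k ≤ (k + 1) ^ k := by
        rw [h3]; gcongr
      exact_mod_cast h4
    calc (k+1).factorial * 2 ^ (k+1) = (k + 1) * 2 * (k.factorial * 2 ^ k) := by
          rw [Nat.factorial_succ, pow_succ]; ring
      _ ≤ (k + 1) * 2 * (2 * k ^ k) := by gcongr
      _ ≤ (k + 1) * 2 * (k + 1) ^ k := by gcongr
      _ = _ := by rw [pow_succ]; ring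

lemma small_bound (r k : ℕ) (hr : 3 ≤ r) (hk : 1 ≤ k) :
    (((r * k).factorial : ℝ) / ((r.factorial : ℝ) ^ k * (k.factorial : ℝ))) *
      ((2 * k) / ((r * k).choose r : ℝ)) ^ k ≤ 4 / 2 ^ k := by
  have hk0 : (0:ℝ) < k := by exact_mod_cast hk
  have hN : (0:ℝ) < ((r * k).choose r : ℝ) := by
    exact_mod_cast Nat.choose_pos (by nlinarith)
  set N : ℝ := ((r * k).choose r : ℝ) with hNdef
  set Pj : ℝ := ∏ j ∈ Finset.range k, ((r * (j + 1)).choose r : ℝ) with hPj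
  have h1 : ((r * k).factorial : ℝ) = (r.factorial : ℝ) ^ k * Pj := by
    rw [fact_prod, hPj]; push_cast; rfl
  have h2 : Pj * ((k:ℝ) ^ r) ^ k ≤ N ^ k * (k.factorial : ℝ) ^ r := by
    have e1 : ∀ c : ℝ, c ^ k = ∏ _j ∈ Finset.range k, c := by intro c; simp
    have e2 : (k.factorial : ℝ) ^ r = ∏ j ∈ Finset.range k, ((j:ℝ) + 1) ^ r := by
      rw [← Finset.prod_range_add_one_eq_factorial, Finset.prod_pow]; push_cast; rfl
    rw [e2, e1 ((k:ℝ) ^ r), e1 N, hPj, ← Finset.prod_mul_distrib, ← Finset.prod_mul_distrib]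
    apply Finset.prod_le_prod
    · intros; positivity
    · intro j hj
      have := choose_ratio r (j+1) k (by omega) (Finset.mem_range.1 hj)
      rw [hNdef]; exact_mod_cast this
  have hf0 : (0:ℝ) < k.factorial := by exact_mod_cast Nat.factorial_pos k
  have hr0 : (0:ℝ) < (r.factorial : ℝ) ^ k := by
    have : (0:ℝ) < r.factorial := by exact_mod_cast Nat.factorial_pos r
    positivity
  set a : ℝ := k.factorial / (k:ℝ) ^ k with ha
  have ha0 : 0 < a := by positivity
  have ha2 : a * 2 ^ k ≤ 2 := by
    have : (k.factorial : ℝ) * 2 ^ k ≤ 2 * (k:ℝ) ^ k := by exact_mod_cast fact_two_pow k hk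
    rw [ha, div_mul_eq_mul_div, div_le_iff₀ (by positivity)]
    exact this
  have ha1 : a ≤ 1 := by
    have h3 : (2:ℝ) ^ 1 ≤ 2 ^ k := pow_le_pow_right₀ (by norm_num) hk
    nlinarith
  have h3 : Pj / N ^ k ≤ a ^ r := by
    rw [ha, div_pow, div_le_div_iff₀ (by positivity) (by positivity)]
    have : ((k:ℝ) ^ k) ^ r = ((k:ℝ) ^ r) ^ k := by rw [← pow_mul, ← pow_mul, mul_comm]
    rw [this]; linarith
  obtain ⟨t, rfl⟩ : ∃ t, r = t + 3 := ⟨r - 3, by omega⟩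
  calc _ = (Pj / N ^ k) * (2 ^ k * a⁻¹) := by
        rw [h1, ha, div_pow, mul_pow]; field_simp
    _ ≤ a ^ (t + 3) * (2 ^ k * a⁻¹) := by gcongr
    _ = a ^ t * (a ^ 2 * 2 ^ k) := by field_simp; ring
    _ ≤ 1 * (a ^ 2 * 2 ^ k) := by gcongr; exact pow_le_one₀ ha0.le ha1
    _ ≤ 4 / 2 ^ k := by
        rw [one_mul, le_div_iff₀ (by positivity)]
        have : 0 < a * 2 ^ k := by positivity
        nlinarith

lemma prod_lower (k : ℕ) : ∀ y : ℝ, (k:ℝ) < y →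
    Real.exp ((y * Real.log y - y) - ((y - k) * Real.log (y - k) - (y - k))) ≤
      ∏ i ∈ Finset.range k, (y - i) := by
  induction k with
  | zero => intro y hy; simp
  | succ k ih =>
    intro y hy
    push_cast at hy
    have h1 := ih y (by linarith)
    rw [Finset.prod_range_succ]
    set z := y - k with hz
    have hz1 : 1 < z := by linarith
    have h2 : (z - 1) * (Real.log z - Real.log (z - 1)) ≤ 1 := by
      rw [← Real.log_div (by linarith) (by linarith)]
      have h3 := Real.log_le_sub_one_of_pos (x := z / (z - 1)) (by apply div_pos <;> linarith)
      have h4 : z / (z - 1) - 1 = 1 / (z - 1) := by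
        have : z - 1 ≠ 0 := by linarith
        field_simp; ring
      rw [h4] at h3
      calc _ ≤ (z - 1) * (1 / (z - 1)) := mul_le_mul_of_nonneg_left h3 (by linarith)
        _ = 1 := by
          have : z - 1 ≠ 0 := by linarith
          field_simp
    have h5 : Real.exp ((y * Real.log y - y) - ((y - (k+1 : ℕ)) * Real.log (y - (k+1:ℕ)) - (y - (k+1:ℕ)))) ≤
        Real.exp ((y * Real.log y - y) - (z * Real.log z - z)) * z := by
      nth_rewrite 4 [← Real.exp_log (show 0 < z by linarith)]
      rw [← Real.exp_add]
      apply Real.exp_le_exp.2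
      have e1 : y - ((k + 1 : ℕ) : ℝ) = z - 1 := by rw [hz]; push_cast; ring
      rw [e1]
      nlinarith
    exact h5.trans (mul_le_mul_of_nonneg_right h1 (by linarith))

lemma desc_lower (k : ℕ) (hk : 1 ≤ k) (μ : ℝ) (hμ : 2 * (k:ℝ) ≤ μ) :
    μ ^ k * Real.exp (-(μ - k) * Real.log (1 - k / μ) - k) ≤ 2 * ((⌊μ⌋₊.descFactorial k : ℕ) : ℝ) := by
  have hk0 : (1:ℝ) ≤ k := by exact_mod_cast hk
  have hμ0 : 0 < μ := by linarith
  have hm : μ < ⌊μ⌋₊ + 1 := Nat.lt_floor_add_one μ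
  have hkm : k ≤ ⌊μ⌋₊ := Nat.le_floor (by linarith)
  have h1 : ∏ i ∈ Finset.range k, (μ - (i + 1 : ℕ)) ≤ ((⌊μ⌋₊.descFactorial k : ℕ) : ℝ) := by
    rw [Nat.descFactorial_eq_prod_range, Nat.cast_prod]
    apply Finset.prod_le_prod
    · intro i hi
      have : ((i + 1 : ℕ) : ℝ) ≤ k := by exact_mod_cast Finset.mem_range.1 hi
      linarith
    · intro i hi
      have hi' := Finset.mem_range.1 hi
      rw [Nat.cast_sub (by omega)]
      push_cast; linarith
  have h2 := prod_lower k μ (by linarith)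
  have h3 : (∏ i ∈ Finset.range k, (μ - (i + 1 : ℕ))) * μ = (∏ i ∈ Finset.range k, (μ - i)) * (μ - k) := by
    rw [← Finset.prod_range_succ (fun i : ℕ => μ - (i : ℝ)), Finset.prod_range_succ']
    simp
  have hpos : 0 ≤ ∏ i ∈ Finset.range k, (μ - (i + 1 : ℕ)) := by
    apply Finset.prod_nonneg
    intro i hi
    have : ((i + 1 : ℕ) : ℝ) ≤ k := by exact_mod_cast Finset.mem_range.1 hi
    linarith
  have hpos2 : 0 ≤ ∏ i ∈ Finset.range k, (μ - (i : ℝ)) := by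
    apply Finset.prod_nonneg
    intro i hi
    have : (i : ℝ) ≤ k := by exact_mod_cast (Finset.mem_range.1 hi).le
    linarith
  have h4 : ∏ i ∈ Finset.range k, (μ - (i : ℝ)) ≤ 2 * ∏ i ∈ Finset.range k, (μ - (i + 1 : ℕ)) := by
    by_contra hc
    push Not at hc
    nlinarith
  have h5 : μ ^ k * Real.exp (-(μ - k) * Real.log (1 - k / μ) - k) =
      Real.exp ((μ * Real.log μ - μ) - ((μ - k) * Real.log (μ - k) - (μ - k))) := by
    have e1 : 1 - k / μ = (μ - k) / μ := by field_simp
    rw [e1, Real.log_div (by linarith) hμ0.ne']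
    have e2 : μ ^ k = Real.exp (k * Real.log μ) := by
      rw [← Real.exp_log (pow_pos hμ0 k), Real.log_pow]
    rw [e2, ← Real.exp_add]
    congr 1; ring
  rw [h5]
  linarith

lemma sigma_lower (n r : ℕ) (p : ℝ) (hp0 : 0 < p) (hp1 : p < 1) (hk : 1 ≤ n / r)
    (hμ : 2 * ((n / r : ℕ) : ℝ) ≤ muR n r p) :
    ((n.factorial : ℝ) / ((r.factorial : ℝ) ^ (n / r) * ((n / r).factorial : ℝ))) *
      p ^ ((n / r) * r.choose 2) *
      Real.exp (-(muR n r p - (n / r : ℕ)) * Real.log (1 - (n / r : ℕ) / muR n r p) - (n / r : ℕ)) ≤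
    2 * SigmaNM n r ⌊muR n r p⌋₊ ∧ 0 < SigmaNM n r ⌊muR n r p⌋₊ := by
  set k := n / r with hkdef
  have hk0 : (1:ℝ) ≤ k := by exact_mod_cast hk
  set μ := muR n r p with hμdef
  set N := n.choose r with hN
  have hμN : μ ≤ N := by
    rw [hμdef, muR]
    have : p ^ r.choose 2 ≤ 1 := pow_le_one₀ hp0.le hp1.le
    have h2 : (0:ℝ) ≤ N := by positivity
    nlinarith
  have hkN : k ≤ N := by
    have : (k:ℝ) ≤ N := by linarith
    exact_mod_cast this
  have hNpos : (0:ℝ) < N := by linarith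
  have h1 := desc_lower k hk μ hμ
  have hM : 0 < ((n.factorial : ℝ) / ((r.factorial : ℝ) ^ k * (k.factorial : ℝ))) := by
    have := Nat.factorial_pos n
    have := Nat.factorial_pos r
    have := Nat.factorial_pos k
    positivity
  set M := ((n.factorial : ℝ) / ((r.factorial : ℝ) ^ k * (k.factorial : ℝ))) with hMdef
  have hdN : (0:ℝ) < (N.descFactorial k : ℝ) := by
    exact_mod_cast Nat.pos_of_ne_zero (fun h => by
      rw [Nat.descFactorial_eq_zero_iff_lt] at h; omega)
  have hdN2 : (N.descFactorial k : ℝ) ≤ (N:ℝ) ^ k := by exact_mod_cast Nat.descFactorial_le_pow N k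
  have hdm : (0:ℝ) < ((⌊μ⌋₊.descFactorial k : ℕ) : ℝ) := by
    have : k ≤ ⌊μ⌋₊ := Nat.le_floor (by linarith)
    exact_mod_cast Nat.pos_of_ne_zero (fun h => by
      rw [Nat.descFactorial_eq_zero_iff_lt] at h; omega)
  have hS : SigmaNM n r ⌊μ⌋₊ = M * (((⌊μ⌋₊.descFactorial k : ℕ) : ℝ) / (N.descFactorial k : ℝ)) := rfl
  have hpk : p ^ (k * r.choose 2) = μ ^ k / (N:ℝ) ^ k := by
    rw [hμdef, muR, mul_pow, ← pow_mul, mul_comm k]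
    rw [← hN]
    field_simp
  refine ⟨?_, by rw [hS]; positivity⟩
  rw [hS, hpk]
  calc M * (μ ^ k / (N:ℝ) ^ k) * Real.exp (-(μ - k) * Real.log (1 - k / μ) - k)
      = M * ((μ ^ k * Real.exp (-(μ - k) * Real.log (1 - k / μ) - k)) / (N:ℝ) ^ k) := by ring
    _ ≤ M * ((2 * ((⌊μ⌋₊.descFactorial k : ℕ) : ℝ)) / (N.descFactorial k : ℝ)) := by
        gcongr
    _ = _ := by ring

end analytic


section numeric

lemma pow_cond (n : ℕ) (hn : 1 ≤ n) (p e : ℝ) (hp0 : 0 < p) (a b : ℕ)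
    (hp : p ≤ (n:ℝ) ^ e) (h : (a:ℝ) + b * e ≤ 0) : (n:ℝ) ^ a * p ^ b ≤ 1 := by
  have hn0 : (0:ℝ) < n := by exact_mod_cast hn
  have hn1 : (1:ℝ) ≤ n := by exact_mod_cast hn
  calc (n:ℝ) ^ a * p ^ b ≤ (n:ℝ) ^ a * ((n:ℝ) ^ e) ^ b := by gcongr
    _ = (n:ℝ) ^ ((a:ℝ) + b * e) := by
      rw [← Real.rpow_natCast (n:ℝ) a, ← Real.rpow_natCast _ b, ← Real.rpow_mul hn0.le,
        ← Real.rpow_add hn0, mul_comm e]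
    _ ≤ 1 := Real.rpow_le_one_of_one_le_of_nonpos hn1 h

lemma choose_two_dbl (j : ℕ) : 2 * j.choose 2 = j * (j - 1) := by
  rw [Nat.choose_two_right, Nat.mul_div_cancel' (Nat.even_mul_pred_self j).two_dvd]

lemma choose_two_diff (r j : ℕ) (hj : 1 ≤ j) (hjr : j ≤ r) :
    2 * (r.choose 2 - j.choose 2) = (r - j) * (r + j - 1) := by
  have h1 := choose_two_dbl r
  have h2 := choose_two_dbl j
  obtain ⟨s, rfl⟩ : ∃ s, r = j + s := ⟨r - j, by omega⟩
  obtain ⟨t, rfl⟩ : ∃ t, j = t + 1 := ⟨j - 1, by omega⟩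
  have e1 : t + 1 + s - 1 = t + s := by omega
  have e2 : t + 1 + s - (t + 1) = s := by omega
  have e3 : t + 1 + s + (t + 1) - 1 = 2 * t + s + 1 := by omega
  rw [e1] at h1
  rw [e2, e3, Nat.mul_sub, h1, h2]
  simp only [Nat.add_sub_cancel]
  apply Nat.sub_eq_of_eq_add
  ring

lemma term_le_one (n r j : ℕ) (p : ℝ) (hp0 : 0 < p) (hp1 : p < 1)
    (hj : 2 ≤ j) (hjr : j < r) (h : (n:ℝ) ^ 2 * p ^ (r + 1) ≤ 1) :
    (n:ℝ) ^ (r - j) * p ^ (r.choose 2 - j.choose 2) ≤ 1 := by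
  have h0 : (0:ℝ) ≤ (n:ℝ) ^ (r - j) * p ^ (r.choose 2 - j.choose 2) := by positivity
  rw [← pow_le_one_iff_of_nonneg h0 (n := 2) (by norm_num)]
  calc ((n:ℝ) ^ (r - j) * p ^ (r.choose 2 - j.choose 2)) ^ 2
      = ((n:ℝ) ^ 2) ^ (r - j) * p ^ (2 * (r.choose 2 - j.choose 2)) := by
        rw [mul_pow, ← pow_mul, ← pow_mul, ← pow_mul, mul_comm 2 (r - j),
          mul_comm 2 (r.choose 2 - j.choose 2)]
    _ ≤ ((n:ℝ) ^ 2) ^ (r - j) * p ^ ((r + 1) * (r - j)) := by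
        rw [choose_two_diff r j (by omega) hjr.le]
        gcongr ?_ * ?_
        apply pow_le_pow_of_le_one hp0.le hp1.le
        rw [mul_comm]
        apply Nat.mul_le_mul_left; omega
    _ = ((n:ℝ) ^ 2 * p ^ (r + 1)) ^ (r - j) := by
        rw [mul_pow, ← pow_mul p]
    _ ≤ 1 := pow_le_one₀ (by positivity) h

lemma sum_choose_Ico (r : ℕ) : ∑ j ∈ Finset.Ico 2 r, (r.choose j : ℝ) ≤ 2 ^ r := by
  have := Nat.sum_range_choose r
  have h2 : ∑ j ∈ Finset.Ico 2 r, r.choose j ≤ ∑ j ∈ Finset.range (r + 1), r.choose j := by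
    apply Finset.sum_le_sum_of_subset
    intro j hj
    simp only [Finset.mem_Ico, Finset.mem_range] at *
    omega
  rw [this] at h2
  exact_mod_cast h2

lemma DD_le (n r : ℕ) (p : ℝ) (hp0 : 0 < p) (hp1 : p < 1)
    (h : (n:ℝ) ^ 2 * p ^ (r + 1) ≤ 1) : DD n r p ≤ 2 ^ r := by
  refine le_trans ?_ (sum_choose_Ico r)
  unfold DD
  apply Finset.sum_le_sum
  intro j hj
  obtain ⟨hj1, hj2⟩ := Finset.mem_Ico.1 hj
  have := term_le_one n r j p hp0 hp1 hj1 hj2 h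
  have h0 : (0:ℝ) ≤ (r.choose j : ℝ) := by positivity
  rw [mul_assoc]
  nlinarith

lemma lower_np (r k : ℕ) (p : ℝ) (hr : 3 ≤ r) (hk : 1 ≤ k) (hp0 : 0 < p)
    (hμ : 2 * (k:ℝ) ≤ muR (r * k) r p) : 1 ≤ (((r * k : ℕ)) : ℝ) ^ 2 * p ^ r := by
  have hk0 : (0:ℝ) < k := by exact_mod_cast hk
  have hr0 : (0:ℝ) < r := by exact_mod_cast (by omega : 0 < r)
  set n : ℝ := ((r * k : ℕ) : ℝ) with hn
  have hn' : n = r * k := by rw [hn]; push_cast; ring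
  have hn0 : 0 < n := by rw [hn']; positivity
  have hf : (0:ℝ) < r.factorial := by exact_mod_cast Nat.factorial_pos r
  have h1 : ((r * k).choose r : ℝ) ≤ n ^ r / r.factorial := by
    have := Nat.choose_le_pow_div (α := ℝ) r (r * k)
    exact this
  have hfr : (r:ℝ) ≤ r.factorial := by exact_mod_cast Nat.self_le_factorial r
  have hpC : 0 < p ^ r.choose 2 := by positivity
  have h2 : n ≤ n ^ r * p ^ r.choose 2 := by
    have h3 : 2 * (k:ℝ) ≤ n ^ r / r.factorial * p ^ r.choose 2 := by
      refine le_trans hμ ?_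
      unfold muR
      gcongr
    rw [div_mul_eq_mul_div, le_div_iff₀ hf] at h3
    rw [hn'] at *
    nlinarith
  obtain ⟨s, rfl⟩ : ∃ s, r = s + 1 := ⟨r - 1, by omega⟩
  have h3 : 1 ≤ n ^ s * p ^ (s+1).choose 2 := by
    rw [pow_succ] at h2
    by_contra hc
    push Not at hc
    nlinarith
  have h4 : (n ^ 2 * p ^ (s+1)) ^ s = (n ^ s * p ^ (s+1).choose 2) ^ 2 := by
    have := choose_two_dbl (s+1)
    rw [mul_pow, mul_pow, ← pow_mul, ← pow_mul, ← pow_mul, ← pow_mul, mul_comm _ 2, mul_comm _ 2, this]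
    simp [mul_comm]
  have h5 : 1 ≤ (n ^ 2 * p ^ (s+1)) ^ s := by
    rw [h4]; exact one_le_pow₀ h3
  rwa [one_le_pow_iff_of_nonneg (by positivity) (by omega)] at h5

lemma term_gen (r j : ℕ) (n p : ℝ) (hn : 1 ≤ n) (hr : 4 ≤ r) (hp0 : 0 < p)
    (hj : 2 ≤ j) (hjr : j < r) (h : 1 ≤ n ^ 2 * p ^ r) :
    n ^ 2 * (n ^ (r - j) * p ^ (r.choose 2 - j.choose 2)) ≤
      n ^ r * p ^ r.choose 2 * Real.sqrt n := by
  have hn0 : 0 < n := by linarith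
  have h1 : 1 ≤ n ^ (2 * j - 3) * p ^ (j * (j - 1)) := by
    rw [← one_le_pow_iff_of_nonneg (by positivity) (by omega : r ≠ 0)]
    have hexp : 2 * (j * (j - 1)) ≤ (2 * j - 3) * r := by
      obtain ⟨t, rfl⟩ : ∃ t, j = t + 2 := ⟨j - 2, by omega⟩
      obtain ⟨s, rfl⟩ : ∃ s, r = t + 3 + s := ⟨r - (t + 3), by omega⟩
      have e1 : t + 2 - 1 = t + 1 := by omega
      have e2 : 2 * (t + 2) - 3 = 2 * t + 1 := by omega
      rw [e1, e2]
      have : 1 ≤ t + s := by omega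
      nlinarith [Nat.zero_le (s * t)]
    calc 1 ≤ (n ^ 2 * p ^ r) ^ (j * (j - 1)) := one_le_pow₀ h
      _ = n ^ (2 * (j * (j - 1))) * p ^ (j * (j - 1) * r) := by
        rw [mul_pow, ← pow_mul, ← pow_mul, mul_comm r]
      _ ≤ n ^ ((2 * j - 3) * r) * p ^ (j * (j - 1) * r) := by
        gcongr
      _ = _ := by rw [mul_pow, ← pow_mul, ← pow_mul]
  have h2 : 1 ≤ n ^ (j - 2) * p ^ j.choose 2 * Real.sqrt n := by
    rw [← one_le_pow_iff_of_nonneg (by positivity) (by omega : 2 ≠ 0)]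
    rw [mul_pow, Real.sq_sqrt hn0.le, mul_pow, ← pow_mul, ← pow_mul, mul_comm _ 2, mul_comm _ 2,
      choose_two_dbl]
    have : 2 * j - 3 = 2 * (j - 2) + 1 := by omega
    rw [this, pow_succ] at h1
    linarith
  have hC : j.choose 2 ≤ r.choose 2 := Nat.choose_le_choose 2 hjr.le
  calc n ^ 2 * (n ^ (r - j) * p ^ (r.choose 2 - j.choose 2))
      ≤ n ^ 2 * (n ^ (r - j) * p ^ (r.choose 2 - j.choose 2)) *
        (n ^ (j - 2) * p ^ j.choose 2 * Real.sqrt n) := le_mul_of_one_le_right (by positivity) h2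
    _ = n ^ (2 + (r - j) + (j - 2)) * p ^ ((r.choose 2 - j.choose 2) + j.choose 2) * Real.sqrt n := by
      rw [pow_add, pow_add, pow_add]; ring
    _ = _ := by
      rw [Nat.sub_add_cancel hC]
      congr 3
      omega

lemma err_general (r k : ℕ) (p : ℝ) (hr : 4 ≤ r) (hk : 1 ≤ k) (hp0 : 0 < p)
    (hμ : 2 * (k:ℝ) ≤ muR (r * k) r p) :
    (k:ℝ) ^ 2 / muR (r * k) r p * (p ^ r.choose 2 + DD (r * k) r p) ≤
      (1 + (r:ℝ) ^ r * 2 ^ r) * Real.sqrt ((r * k : ℕ) : ℝ) := by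
  have hk0 : (0:ℝ) < k := by exact_mod_cast hk
  have hk1 : (1:ℝ) ≤ k := by exact_mod_cast hk
  have hr0 : (0:ℝ) < r := by exact_mod_cast (by omega : 0 < r)
  have hr1 : (1:ℝ) ≤ r := by exact_mod_cast (by omega : 1 ≤ r)
  have hlow := lower_np r k p (by omega) hk hp0 hμ
  set n : ℝ := ((r * k : ℕ) : ℝ) with hn
  have hn' : n = r * k := by rw [hn]; push_cast; ring
  have hn1 : 1 ≤ n := by rw [hn']; nlinarith
  have hN : (k:ℝ) ^ r ≤ ((r * k).choose r : ℝ) := by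
    have := choose_ratio r 1 k (by omega) hk
    simp at this
    exact_mod_cast this
  have hN0 : (0:ℝ) < ((r * k).choose r : ℝ) := lt_of_lt_of_le (by positivity) hN
  have hC : 0 < p ^ r.choose 2 := by positivity
  have hmu0 : 0 < muR (r * k) r p := by linarith
  have hs1 : 1 ≤ Real.sqrt n := by rwa [Real.one_le_sqrt]
  have hA : (k:ℝ) ^ 2 / muR (r * k) r p * p ^ r.choose 2 ≤ Real.sqrt n := by
    refine le_trans ?_ hs1
    have : (k:ℝ) ^ 2 / muR (r * k) r p * p ^ r.choose 2 = (k:ℝ) ^ 2 / ((r * k).choose r : ℝ) := by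
      unfold muR; field_simp
    rw [this, div_le_one hN0]
    exact le_trans (pow_le_pow_right₀ hk1 (by omega)) hN
  have hmu : n ^ r * p ^ r.choose 2 ≤ (r:ℝ) ^ r * muR (r * k) r p := by
    unfold muR
    rw [hn', mul_pow]
    calc (r:ℝ) ^ r * (k:ℝ) ^ r * p ^ r.choose 2 = (r:ℝ) ^ r * ((k:ℝ) ^ r * p ^ r.choose 2) := by ring
      _ ≤ _ := by gcongr
  have hB : (k:ℝ) ^ 2 / muR (r * k) r p * DD (r * k) r p ≤ (r:ℝ) ^ r * 2 ^ r * Real.sqrt n := by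
    have hkn : (k:ℝ) ^ 2 ≤ n ^ 2 := by
      rw [hn']; gcongr; nlinarith
    rw [div_mul_eq_mul_div, div_le_iff₀ hmu0]
    calc (k:ℝ) ^ 2 * DD (r * k) r p
        = ∑ j ∈ Finset.Ico 2 r, (r.choose j : ℝ) * ((k:ℝ) ^ 2 *
          (n ^ (r - j) * p ^ (r.choose 2 - j.choose 2))) := by
          unfold DD
          rw [Finset.mul_sum]
          apply Finset.sum_congr rfl
          intro j _
          rw [← hn]; ring
      _ ≤ ∑ j ∈ Finset.Ico 2 r, (r.choose j : ℝ) * ((r:ℝ) ^ r * muR (r * k) r p * Real.sqrt n) := by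
          apply Finset.sum_le_sum
          intro j hj
          obtain ⟨hj1, hj2⟩ := Finset.mem_Ico.1 hj
          refine mul_le_mul_of_nonneg_left ?_ (by positivity)
          have := term_gen r j n p hn1 hr hp0 hj1 hj2 hlow
          calc _ ≤ n ^ 2 * (n ^ (r - j) * p ^ (r.choose 2 - j.choose 2)) := by gcongr
            _ ≤ _ := this
            _ ≤ _ := by gcongr
      _ = (∑ j ∈ Finset.Ico 2 r, (r.choose j : ℝ)) * ((r:ℝ) ^ r * muR (r * k) r p * Real.sqrt n) := by
          rw [Finset.sum_mul]
      _ ≤ 2 ^ r * ((r:ℝ) ^ r * muR (r * k) r p * Real.sqrt n) := by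
          gcongr
          exact sum_choose_Ico r
      _ = _ := by ring
  rw [mul_add]
  linarith

lemma err_three (n k μ x p : ℝ) (hn : 10000 ≤ n) (hk : 0 < k) (hkn : n = 3 * k) (hp0 : 0 < p)
    (hp1 : p < 1) (hc : n ^ 5 * p ^ 8 ≤ 1) (hμ : 2 * k ≤ μ) (hx : x = k / μ) :
    x * (3 * (n * p ^ 2 + 4 * p)) ≤ 1 ∧
    -(x * (1 - x * (3 * (n * p ^ 2 + 4 * p))) *
      (μ - k * p ^ 3 + 3 * k * (n - 3) * (p ^ 2 - p ^ 3))) ≤ -k + 70 * Real.sqrt n := by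
  have hn0 : 0 < n := by linarith
  have hμ0 : 0 < μ := by linarith
  have hx0 : 0 < x := by rw [hx]; positivity
  have hx2 : x ≤ 1 / 2 := by rw [hx, div_le_iff₀ hμ0]; linarith
  have hxμ : x * μ = k := by rw [hx]; field_simp
  obtain ⟨y, hy⟩ : ∃ y, y = n * p ^ 2 := ⟨_, rfl⟩
  have hy0 : 0 < y := by rw [hy]; positivity
  have hy4 : n * y ^ 4 ≤ 1 := by rw [hy]; calc _ = n ^ 5 * p ^ 8 := by ring
                                    _ ≤ 1 := hc
  have hy1 : y ≤ 1 / 10 := by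
    by_contra hcon
    push Not at hcon
    have : (1/10:ℝ) ^ 4 < y ^ 4 := by gcongr
    nlinarith
  have hp2 : p ≤ 1 / 100 := by
    by_contra hcon
    push Not at hcon
    have : (1/100:ℝ) ^ 2 < p ^ 2 := by gcongr
    nlinarith
  have hs := Real.sqrt_nonneg n
  have hss : Real.sqrt n ^ 2 = n := Real.sq_sqrt hn0.le
  set s := Real.sqrt n with hsdef
  have b1 : n * p ≤ s := by
    apply Real.le_sqrt_of_sq_le
    have : (n * p) ^ 2 = n * y := by rw [hy]; ring
    rw [this]; nlinarith
  have b2 : n * (n * p ^ 3) ≤ s := by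
    have : n * (n * p ^ 3) = (n * p) * y := by rw [hy]; ring
    rw [this]; nlinarith
  have b3 : n * (n ^ 2 * p ^ 4) ≤ s := by
    apply Real.le_sqrt_of_sq_le
    have : (n * (n ^ 2 * p ^ 4)) ^ 2 = n * (n * y ^ 4) := by rw [hy]; ring
    rw [this]; nlinarith
  have hε0 : 0 < 3 * (n * p ^ 2 + 4 * p) := by positivity
  have hε : 3 * (n * p ^ 2 + 4 * p) ≤ 1 := by rw [← hy]; linarith
  refine ⟨by nlinarith, ?_⟩
  set ε := 3 * (n * p ^ 2 + 4 * p) with hεd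
  set A := -k * p ^ 3 + 3 * k * (n - 3) * (p ^ 2 - p ^ 3) with hA
  have hA1 : A ≤ k * (3 * (n * p ^ 2)) := by
    have : k * (3 * (n * p ^ 2)) - A = k * (p ^ 3 + 3 * (n * p ^ 3 + 3 * (p ^ 2 - p ^ 3))) := by
      rw [hA]; ring
    have h2 : p ^ 3 ≤ p ^ 2 := pow_le_pow_of_le_one hp0.le hp1.le (by norm_num)
    have h3 : 0 ≤ k * (p ^ 3 + 3 * (n * p ^ 3 + 3 * (p ^ 2 - p ^ 3))) := by
      have : 0 ≤ p ^ 2 - p ^ 3 := by linarith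
      positivity
    linarith
  have e1 : -(x * (1 - x * ε) * (μ - k * p ^ 3 + 3 * k * (n - 3) * (p ^ 2 - p ^ 3))) =
      -(x * μ) + x * ε * (x * μ) - x * A + x * x * ε * A := by rw [hA]; ring
  rw [e1, hxμ]
  have e2 : x * x * ε * A ≤ x * k * (ε * (3 * (n * p ^ 2))) := by
    calc x * x * ε * A ≤ x * x * ε * (k * (3 * (n * p ^ 2))) := by gcongr
      _ = x * (x * k * (ε * (3 * (n * p ^ 2)))) := by ring
      _ ≤ 1 * (x * k * (ε * (3 * (n * p ^ 2)))) := by gcongr; linarith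
      _ = _ := one_mul _
  have e3 : x * ε * k - x * A + x * k * (ε * (3 * (n * p ^ 2))) ≤
      x * k * (12 * p + p ^ 3 + 9 * p ^ 2 + 3 * (n * p ^ 3) + 9 * (n ^ 2 * p ^ 4) + 36 * (n * p ^ 3)) := by
    have : x * k * (12 * p + p ^ 3 + 9 * p ^ 2 + 3 * (n * p ^ 3) + 9 * (n ^ 2 * p ^ 4) + 36 * (n * p ^ 3))
      - (x * ε * k - x * A + x * k * (ε * (3 * (n * p ^ 2)))) = x * k * (9 * p ^ 3) := by
      rw [hA, hεd]; ring
    have h2 : 0 ≤ x * k * (9 * p ^ 3) := by positivity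
    linarith
  have hp3 : p ^ 3 ≤ p := by nlinarith [pow_le_pow_of_le_one hp0.le hp1.le (by norm_num : 1 ≤ 3)]
  have hpp : p ^ 2 ≤ p := by nlinarith
  have e4 : x * k * (12 * p + p ^ 3 + 9 * p ^ 2 + 3 * (n * p ^ 3) + 9 * (n ^ 2 * p ^ 4) + 36 * (n * p ^ 3))
      ≤ n * (22 * p + 39 * (n * p ^ 3) + 9 * (n ^ 2 * p ^ 4)) := by
    have : x * k ≤ n := by nlinarith
    calc _ ≤ n * (12 * p + p ^ 3 + 9 * p ^ 2 + 3 * (n * p ^ 3) + 9 * (n ^ 2 * p ^ 4) + 36 * (n * p ^ 3)) := by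
          gcongr
      _ ≤ _ := mul_le_mul_of_nonneg_left (by linarith) hn0.le
  have e5 : n * (22 * p + 39 * (n * p ^ 3) + 9 * (n ^ 2 * p ^ 4)) ≤ 70 * s := by
    have : n * (22 * p + 39 * (n * p ^ 3) + 9 * (n ^ 2 * p ^ 4)) =
      22 * (n * p) + 39 * (n * (n * p ^ 3)) + 9 * (n * (n ^ 2 * p ^ 4)) := by ring
    linarith
  linarith

end numeric

section final

lemma err_all (r : ℕ) (hr : 3 ≤ r) : ∃ K0 : ℝ, 0 < K0 ∧ ∀ (n : ℕ) (p : ℝ), 10000 ≤ n → r ∣ n →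
    1 ≤ n / r → 0 < p → p < 1 →
    (r = 3 → (n:ℝ) ^ 5 * p ^ 8 ≤ 1) → 2 * ((n / r : ℕ) : ℝ) ≤ muR n r p →
    ∀ P ∈ Fac n r, EE (pairsUniv n) p
      (fun G => (1 - ((n / r : ℕ) : ℝ) / muR n r p) ^ (cliqueHyp n r (G ∪ PE P)).card) ≤
      (1 - ((n / r : ℕ) : ℝ) / muR n r p) ^ (n / r) *
        Real.exp (-((n / r : ℕ) : ℝ) + K0 * Real.sqrt n) := by
  rcases Nat.lt_or_ge r 4 with h4 | h4
  · obtain rfl : r = 3 := by omega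
    refine ⟨70, by norm_num, ?_⟩
    intro n p hn hrn hk hp0 hp1 hc hμ P hP
    have hk0 : (0:ℝ) < ((n / 3 : ℕ) : ℝ) := by exact_mod_cast hk
    have hnk : (n:ℝ) = 3 * ((n / 3 : ℕ) : ℝ) := by
      exact_mod_cast (Nat.mul_div_cancel' hrn).symm
    have hμ0 : 0 < muR n 3 p := by linarith
    obtain ⟨h1, h2⟩ := err_three n ((n / 3 : ℕ) : ℝ) (muR n 3 p) (((n / 3 : ℕ) : ℝ) / muR n 3 p) p
      (by exact_mod_cast hn) hk0 hnk hp0 hp1 (hc rfl) hμ rfl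
    have hx1 : ((n / 3 : ℕ) : ℝ) / muR n 3 p ≤ 1 := by
      rw [div_le_one hμ0]; linarith
    refine le_trans (planted_three p _ hp0 hp1 (by positivity) hx1 h1 P hP) ?_
    have hx3 : 0 ≤ 1 - ((n / 3 : ℕ) : ℝ) / muR n 3 p := by linarith
    exact mul_le_mul_of_nonneg_left (Real.exp_le_exp.2 h2) (by positivity)
  · refine ⟨1 + (r:ℝ) ^ r * 2 ^ r, by positivity, ?_⟩
    intro n p hn hrn hk hp0 hp1 hc hμ P hP
    have hk0 : (0:ℝ) < ((n / r : ℕ) : ℝ) := by exact_mod_cast hk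
    have hμ0 : 0 < muR n r p := by linarith
    have hx1 : ((n / r : ℕ) : ℝ) / muR n r p ≤ 1 := by
      rw [div_le_one hμ0]; linarith
    refine le_trans (planted_general p _ hp0 hp1 (by positivity) hx1 P hP) ?_
    have hx3 : 0 ≤ 1 - ((n / r : ℕ) : ℝ) / muR n r p := by linarith
    refine mul_le_mul_of_nonneg_left (Real.exp_le_exp.2 ?_) (by positivity)
    have h := err_general r (n / r) p h4 hk hp0 (by rwa [Nat.mul_div_cancel' hrn])
    rw [Nat.mul_div_cancel' hrn] at h
    have e : -(((n / r : ℕ) : ℝ) / muR n r p) * (muR n r p - ((n / r : ℕ) : ℝ) * p ^ r.choose 2) +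
        (((n / r : ℕ) : ℝ) / muR n r p) ^ 2 * (muR n r p * DD n r p) =
        -((n / r : ℕ) : ℝ) + ((n / r : ℕ) : ℝ) ^ 2 / muR n r p * (p ^ r.choose 2 + DD n r p) := by
      field_simp
      ring
    rw [e]
    linarith

lemma bad_small (n r : ℕ) (p B : ℝ) (hr : 3 ≤ r) (hrn : r ∣ n) (hk : 1 ≤ n / r)
    (hp0 : 0 < p) (hp1 : p < 1) (hB : 0 ≤ B) (hμ : muR n r p < 2 * ((n / r : ℕ) : ℝ)) :
    EE (pairsUniv n) p (fun G => if B < (numFactors n r G : ℝ) then 1 else 0) ≤ 4 / 2 ^ (n / r) := by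
  have h1 : EE (pairsUniv n) p (fun G => if B < (numFactors n r G : ℝ) then 1 else 0) ≤
      EE (pairsUniv n) p (fun G => (numFactors n r G : ℝ) * 1) := by
    apply EE_mono _ _ hp0 hp1
    intro G _
    split_ifs with h
    · have : 0 < numFactors n r G := by
        have : (0:ℝ) < numFactors n r G := lt_of_le_of_lt hB h
        exact_mod_cast this
      have : (1:ℝ) ≤ numFactors n r G := by exact_mod_cast this
      linarith
    · positivity
  rw [E_numFactors n r p (fun _ => 1)] at h1
  simp only [EE_const, mul_one, Finset.sum_const, nsmul_eq_mul] at h1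
  refine le_trans h1 ?_
  have hsb := small_bound r (n / r) hr hk
  rw [Nat.mul_div_cancel' hrn] at hsb
  refine le_trans ?_ hsb
  have hf : (0:ℝ) < (r.factorial : ℝ) ^ (n / r) * ((n / r).factorial : ℝ) := by
    have h1 : (0:ℝ) < r.factorial := by exact_mod_cast Nat.factorial_pos r
    have h2 : (0:ℝ) < (n / r).factorial := by exact_mod_cast Nat.factorial_pos _
    positivity
  have hN : (0:ℝ) < (n.choose r : ℝ) := by
    have : r ≤ n := by
      rcases Nat.lt_or_ge n r with h | h
      · rw [Nat.div_eq_of_lt h] at hk; omega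
      · exact h
    exact_mod_cast Nat.choose_pos this
  have hc : ((Fac n r).card : ℝ) ≤ (n.factorial : ℝ) / ((r.factorial : ℝ) ^ (n / r) * ((n / r).factorial : ℝ)) := by
    rw [le_div_iff₀ hf]
    exact_mod_cast Fac_card n r hrn
  have hp : p ^ (n / r * r.choose 2) ≤ (2 * ((n / r : ℕ) : ℝ) / (n.choose r : ℝ)) ^ (n / r) := by
    rw [mul_comm, pow_mul]
    gcongr
    rw [le_div_iff₀ hN]
    unfold muR at hμ
    linarith
  exact mul_le_mul hc hp (by positivity) (by positivity)

lemma EF_weighted (n r : ℕ) (p K0 : ℝ) (hrn : r ∣ n) (hk : 1 ≤ n / r)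
    (hp0 : 0 < p) (hp1 : p < 1) (hμ : 2 * ((n / r : ℕ) : ℝ) ≤ muR n r p)
    (herr : ∀ P ∈ Fac n r, EE (pairsUniv n) p
      (fun G => (1 - ((n / r : ℕ) : ℝ) / muR n r p) ^ (cliqueHyp n r (G ∪ PE P)).card) ≤
      (1 - ((n / r : ℕ) : ℝ) / muR n r p) ^ (n / r) *
        Real.exp (-((n / r : ℕ) : ℝ) + K0 * Real.sqrt n)) :
    EE (pairsUniv n) p (fun G => (numFactors n r G : ℝ) *
        (1 - ((n / r : ℕ) : ℝ) / muR n r p) ^ (cliqueHyp n r G).card) ≤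
      2 * SigmaNM n r ⌊muR n r p⌋₊ *
        Real.exp (muR n r p * Real.log (1 - ((n / r : ℕ) : ℝ) / muR n r p) + K0 * Real.sqrt n) := by
  rw [E_numFactors n r p (fun G => (1 - ((n / r : ℕ) : ℝ) / muR n r p) ^ (cliqueHyp n r G).card)]
  obtain ⟨hs, hs0⟩ := sigma_lower n r p hp0 hp1 hk hμ
  have hk0 : (0:ℝ) < ((n / r : ℕ) : ℝ) := by exact_mod_cast hk
  set k := n / r with hkd
  set μ := muR n r p with hμd
  have hμ0 : 0 < μ := by linarith
  have hx : 0 < 1 - (k:ℝ) / μ := by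
    have : (k:ℝ) / μ < 1 := by rw [div_lt_one hμ0]; linarith
    linarith
  set y := 1 - (k:ℝ) / μ with hy
  have hf : (0:ℝ) < (r.factorial : ℝ) ^ k * (k.factorial : ℝ) := by
    have h1 : (0:ℝ) < r.factorial := by exact_mod_cast Nat.factorial_pos r
    have h2 : (0:ℝ) < k.factorial := by exact_mod_cast Nat.factorial_pos _
    positivity
  have hc : ((Fac n r).card : ℝ) ≤ (n.factorial : ℝ) / ((r.factorial : ℝ) ^ k * (k.factorial : ℝ)) := by
    rw [le_div_iff₀ hf]
    exact_mod_cast Fac_card n r hrn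
  set M := (n.factorial : ℝ) / ((r.factorial : ℝ) ^ k * (k.factorial : ℝ)) with hM
  have hyk : y ^ k = Real.exp (k * Real.log y) := by
    rw [Real.exp_nat_mul, Real.exp_log hx]
  calc ∑ P ∈ Fac n r, p ^ (k * r.choose 2) *
        EE (pairsUniv n) p (fun G => y ^ (cliqueHyp n r (G ∪ PE P)).card)
      ≤ ∑ P ∈ Fac n r, p ^ (k * r.choose 2) * (y ^ k * Real.exp (-(k:ℝ) + K0 * Real.sqrt n)) := by
        apply Finset.sum_le_sum
        intro P hP
        exact mul_le_mul_of_nonneg_left (herr P hP) (by positivity)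
    _ = ((Fac n r).card : ℝ) * (p ^ (k * r.choose 2) * (y ^ k * Real.exp (-(k:ℝ) + K0 * Real.sqrt n))) := by
        rw [Finset.sum_const, nsmul_eq_mul]
    _ ≤ M * (p ^ (k * r.choose 2) * (y ^ k * Real.exp (-(k:ℝ) + K0 * Real.sqrt n))) := by
        gcongr
    _ = (M * p ^ (k * r.choose 2) * Real.exp (-(μ - k) * Real.log y - k)) *
        Real.exp (μ * Real.log y + K0 * Real.sqrt n) := by
        rw [hyk, ← Real.exp_add, mul_assoc (M * _), ← Real.exp_add, mul_assoc]
        congr 3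
        ring
    _ ≤ _ := by gcongr

lemma bad_main (n r : ℕ) (p K0 : ℝ) (hn : 3 ≤ n) (hrn : r ∣ n) (hk : 1 ≤ n / r)
    (hr : 3 ≤ r) (hK0 : 0 < K0)
    (hp0 : 0 < p) (hp1 : p < 1) (hμ : 2 * ((n / r : ℕ) : ℝ) ≤ muR n r p)
    (hc : (n:ℝ) ^ 2 * p ^ (r + 1) ≤ 1)
    (herr : ∀ P ∈ Fac n r, EE (pairsUniv n) p
      (fun G => (1 - ((n / r : ℕ) : ℝ) / muR n r p) ^ (cliqueHyp n r (G ∪ PE P)).card) ≤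
      (1 - ((n / r : ℕ) : ℝ) / muR n r p) ^ (n / r) *
        Real.exp (-((n / r : ℕ) : ℝ) + K0 * Real.sqrt n)) :
    EE (pairsUniv n) p (fun G => if Real.exp ((K0 + 3) * Real.sqrt n * Real.log n) *
        SigmaNM n r ⌊muR n r p⌋₊ < (numFactors n r G : ℝ) then 1 else 0) ≤
      (1 + 2 ^ r) / (Real.log n) ^ 2 + 2 / n := by
  have hEF := EF_weighted n r p K0 hrn hk hp0 hp1 hμ herr
  obtain ⟨-, hs0⟩ := sigma_lower n r p hp0 hp1 hk hμ
  have hk0 : (0:ℝ) < ((n / r : ℕ) : ℝ) := by exact_mod_cast hk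
  have hkn : (((n / r : ℕ) : ℝ)) ≤ n := by exact_mod_cast Nat.div_le_self n r
  have hn0 : (0:ℝ) < n := by exact_mod_cast (by omega : 0 < n)
  have hn1 : (1:ℝ) ≤ n := by exact_mod_cast (by omega : 1 ≤ n)
  have hlog : 1 ≤ Real.log n := by
    rw [Real.le_log_iff_exp_le hn0]
    have : (3:ℝ) ≤ n := by exact_mod_cast hn
    linarith [Real.exp_one_lt_d9]
  set L := Real.log n with hL
  set k := n / r with hkd
  set μ := muR n r p with hμd
  set S := SigmaNM n r ⌊μ⌋₊ with hS
  have hμ0 : 0 < μ := by linarith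
  have hsn : 1 ≤ Real.sqrt n := by rwa [Real.one_le_sqrt]
  set d := Real.sqrt μ * L with hd
  have hd0 : 0 < d := by rw [hd]; have := Real.sqrt_pos.2 hμ0; positivity
  have hch := cheb n r p d hp0 hp1 hd0
  have hDD := DD_le n r p hp0 hp1 hc
  have hch2 : (μ + μ * DD n r p) / d ^ 2 ≤ (1 + 2 ^ r) / L ^ 2 := by
    rw [hd, mul_pow, Real.sq_sqrt hμ0.le]
    have : (μ + μ * DD n r p) / (μ * L ^ 2) = (1 + DD n r p) / L ^ 2 := by field_simp
    rw [this]; gcongr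
  have hx : 0 < 1 - (k:ℝ) / μ := by
    have : (k:ℝ) / μ < 1 := by rw [div_lt_one hμ0]; linarith
    linarith
  have hxh : (k:ℝ) / μ ≤ 1 / 2 := by rw [div_le_iff₀ hμ0]; linarith
  set x := (k:ℝ) / μ with hxd
  have hx0 : 0 < x := by rw [hxd]; positivity
  have hlam : -Real.log (1 - x) ≤ 2 * x := by
    have h1 := Real.one_sub_inv_le_log_of_pos hx
    have h2 : (1 - x)⁻¹ - 1 ≤ 2 * x := by
      rw [sub_le_iff_le_add, inv_le_iff_one_le_mul₀ hx]
      nlinarith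
    linarith
  have hlam0 : Real.log (1 - x) ≤ 0 := Real.log_nonpos hx.le (by linarith)
  have hld : -Real.log (1 - x) * d ≤ 2 * Real.sqrt n * L := by
    have hks : (k:ℝ) ≤ Real.sqrt n * Real.sqrt μ := by
      rw [← Real.sqrt_mul hn0.le]
      apply Real.le_sqrt_of_sq_le
      nlinarith
    have hsμ := Real.sqrt_pos.2 hμ0
    have hxs : x * Real.sqrt μ ≤ Real.sqrt n := by
      rw [hxd, div_mul_eq_mul_div, div_le_iff₀ hμ0]
      calc (k:ℝ) * Real.sqrt μ ≤ Real.sqrt n * Real.sqrt μ * Real.sqrt μ := by gcongr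
        _ = Real.sqrt n * μ := by rw [mul_assoc, Real.mul_self_sqrt hμ0.le]
    calc -Real.log (1 - x) * d ≤ 2 * x * d := by gcongr
      _ = 2 * (x * Real.sqrt μ) * L := by rw [hd]; ring
      _ ≤ _ := by gcongr
  set T := Real.exp ((K0 + 3) * Real.sqrt n * L) * S with hT
  have hT0 : 0 < T := by positivity
  have hpt : ∀ G, (if T < (numFactors n r G : ℝ) then (1:ℝ) else 0) ≤
      (if μ + d < ((cliqueHyp n r G).card : ℝ) then 1 else 0) +
      (T⁻¹ * Real.exp (-Real.log (1 - x) * (μ + d))) *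
        ((numFactors n r G : ℝ) * (1 - x) ^ (cliqueHyp n r G).card) := by
    intro G
    have hnn : 0 ≤ (T⁻¹ * Real.exp (-Real.log (1 - x) * (μ + d))) *
        ((numFactors n r G : ℝ) * (1 - x) ^ (cliqueHyp n r G).card) := by positivity
    by_cases h2 : μ + d < ((cliqueHyp n r G).card : ℝ)
    · rw [if_pos h2]
      split_ifs <;> linarith
    · rw [if_neg h2]
      by_cases h1 : T < (numFactors n r G : ℝ)
      · rw [if_pos h1, zero_add]
        push Not at h2
        have e1 : (1 - x) ^ (cliqueHyp n r G).card =
            Real.exp ((cliqueHyp n r G).card * Real.log (1 - x)) := by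
          rw [Real.exp_nat_mul, Real.exp_log hx]
        rw [e1]
        have e2 : 1 ≤ Real.exp (-Real.log (1 - x) * (μ + d)) *
            Real.exp ((cliqueHyp n r G).card * Real.log (1 - x)) := by
          rw [← Real.exp_add]
          apply Real.one_le_exp
          nlinarith
        have e3 : 1 ≤ T⁻¹ * (numFactors n r G : ℝ) := by
          rw [inv_mul_eq_div, one_le_div hT0]; exact h1.le
        calc (1:ℝ) ≤ (T⁻¹ * (numFactors n r G : ℝ)) * (Real.exp (-Real.log (1 - x) * (μ + d)) *
            Real.exp ((cliqueHyp n r G).card * Real.log (1 - x))) := one_le_mul_of_one_le_of_one_le e3 e2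
          _ = _ := by ring
      · rw [if_neg h1]; linarith
  refine le_trans (EE_mono _ _ hp0 hp1 _ _ (fun G _ => hpt G)) ?_
  rw [EE_add, EE_smul]
  refine add_le_add (le_trans hch hch2) ?_
  calc T⁻¹ * Real.exp (-Real.log (1 - x) * (μ + d)) * EE (pairsUniv n) p (fun G =>
        (numFactors n r G : ℝ) * (1 - x) ^ (cliqueHyp n r G).card)
      ≤ T⁻¹ * Real.exp (-Real.log (1 - x) * (μ + d)) *
        (2 * S * Real.exp (μ * Real.log (1 - x) + K0 * Real.sqrt n)) := by gcongr
    _ = 2 * Real.exp (-((K0 + 3) * Real.sqrt n * L) + -Real.log (1 - x) * (μ + d) +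
        (μ * Real.log (1 - x) + K0 * Real.sqrt n)) := by
        rw [Real.exp_add (-((K0 + 3) * Real.sqrt n * L) + -Real.log (1 - x) * (μ + d)), Real.exp_add (-((K0 + 3) * Real.sqrt n * L)), Real.exp_neg ((K0 + 3) * Real.sqrt n * L), hT, mul_inv]
        field_simp
    _ ≤ 2 * Real.exp (-L) := by
        gcongr
        have h1 : Real.sqrt n ≤ Real.sqrt n * L := le_mul_of_one_le_right (by positivity) hlog
        have h2 : L ≤ Real.sqrt n * L := le_mul_of_one_le_left (by linarith) hsn
        nlinarith
    _ = 2 / n := by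
        rw [Real.exp_neg, hL, Real.exp_log hn0]; ring

lemma gnpProb_compl (n : ℕ) (p : ℝ) (F : Finset (Finset (Fin n)) → ℝ) (B : ℝ) :
    gnpProb n p {G | F G ≤ B} = 1 - EE (pairsUniv n) p (fun G => if B < F G then 1 else 0) := by
  have h1 : gnpProb n p {G | F G ≤ B} = EE (pairsUniv n) p (fun G => if F G ≤ B then 1 else 0) := by
    unfold gnpProb EE
    rw [Finset.sum_filter]
    apply Finset.sum_congr rfl
    intro G _
    simp
  rw [h1, ← EE_const (pairsUniv n) p 1, ← EE_sub']
  apply EE_congr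
  intro G _
  by_cases h : F G ≤ B
  · simp [h, not_lt.2 h, EE_const]
  · simp [h, not_le.1 h, EE_const]

end final

theorem Kr_factors_upper_bound (r : ℕ) (hr : 3 ≤ r) :
    ∃ γ K C : ℝ, 0 < γ ∧ 0 < K ∧ 0 < C ∧
      ∀ p : ℕ → ℝ, (∀ n, 0 < p n ∧ p n < 1) →
        (∀ n : ℕ, 1 ≤ n → p n ≤ (n : ℝ) ^ (-2 / (r : ℝ) + γ)) →
        Filter.Tendsto
          (fun n => gnpProb n (p n)
            {G | (numFactors n r G : ℝ) ≤
              Real.exp (K * Real.sqrt n * (Real.log n) ^ (C : ℝ)) *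
                SigmaNM n r ⌊(n.choose r : ℝ) * p n ^ r.choose 2⌋₊})
          (Filter.atTop ⊓ Filter.principal {n : ℕ | r ∣ n}) (nhds 1) := by
  obtain ⟨K0, hK0, herr⟩ := err_all r hr
  have hr0 : (0:ℝ) < r := by exact_mod_cast (by omega : 0 < r)
  have hr3 : (3:ℝ) ≤ r := by exact_mod_cast hr
  refine ⟨1 / (r:ℝ) ^ 3, K0 + 3, 1, by positivity, by linarith, by norm_num, ?_⟩
  intro p hp hpn
  set f : ℕ → ℝ := fun n => EE (pairsUniv n) (p n) (fun G =>
    if Real.exp ((K0 + 3) * Real.sqrt n * Real.log n) * SigmaNM n r ⌊muR n r (p n)⌋₊ <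
      (numFactors n r G : ℝ) then 1 else 0) with hf
  have heq : (fun n => gnpProb n (p n)
            {G | (numFactors n r G : ℝ) ≤
              Real.exp ((K0 + 3) * Real.sqrt n * (Real.log n) ^ (1 : ℝ)) *
                SigmaNM n r ⌊(n.choose r : ℝ) * p n ^ r.choose 2⌋₊}) = fun n => 1 - f n := by
    funext n
    rw [Real.rpow_one]
    exact gnpProb_compl n (p n) (fun G => (numFactors n r G : ℝ)) _
  rw [heq]
  set b : ℕ → ℝ := fun n => 4 / 2 ^ (n / r) + ((1 + 2 ^ r) / (Real.log n) ^ 2 + 2 / n) with hb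
  have hbound : ∀ n : ℕ, max 10000 r ≤ n → r ∣ n → f n ≤ b n := by
    intro n hn hrn
    have hn1 : 10000 ≤ n := le_trans (le_max_left _ _) hn
    have hn2 : r ≤ n := le_trans (le_max_right _ _) hn
    have hk : 1 ≤ n / r := (Nat.one_le_div_iff (by omega)).2 hn2
    obtain ⟨hp0, hp1⟩ := hp n
    have hpp := hpn n (by omega)
    have t1 : (0:ℝ) ≤ 4 / 2 ^ (n / r) := by positivity
    have t2 : (0:ℝ) ≤ (1 + 2 ^ r) / (Real.log n) ^ 2 + 2 / n := by positivity
    rcases lt_or_ge (muR n r (p n)) (2 * ((n / r : ℕ) : ℝ)) with hμ | hμ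
    · have := bad_small n r (p n) (Real.exp ((K0 + 3) * Real.sqrt n * Real.log n) *
        SigmaNM n r ⌊muR n r (p n)⌋₊) hr hrn hk hp0 hp1 (by unfold SigmaNM; positivity) hμ
      simp only [hf, hb]
      linarith
    · have hc : (n:ℝ) ^ 2 * (p n) ^ (r + 1) ≤ 1 := by
        apply pow_cond n (by omega) (p n) _ hp0 2 (r + 1) hpp
        push_cast
        have : (2:ℝ) + ((r:ℝ) + 1) * (-2 / (r:ℝ) + 1 / (r:ℝ) ^ 3) = (-2 * (r:ℝ) ^ 2 + r + 1) / (r:ℝ) ^ 3 := by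
          field_simp; ring
        rw [this]
        apply div_nonpos_of_nonpos_of_nonneg _ (by positivity)
        nlinarith
      have hc3 : r = 3 → (n:ℝ) ^ 5 * (p n) ^ 8 ≤ 1 := by
        intro h3
        apply pow_cond n (by omega) (p n) _ hp0 5 8 hpp
        rw [h3]; norm_num
      have := bad_main n r (p n) K0 (by omega) hrn hk hr hK0 hp0 hp1 hμ hc
        (herr n (p n) hn1 hrn hk hp0 hp1 hc3 hμ)
      simp only [hf, hb]
      linarith
  have hfl : Filter.atTop ⊓ Filter.principal {n : ℕ | r ∣ n} ≤ Filter.atTop := inf_le_left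
  have hb0 : Filter.Tendsto b Filter.atTop (nhds 0) := by
    have h1 : Filter.Tendsto (fun n : ℕ => (4:ℝ) / 2 ^ (n / r)) Filter.atTop (nhds 0) := by
      apply Filter.Tendsto.const_div_atTop
      exact (tendsto_pow_atTop_atTop_of_one_lt (by norm_num : (1:ℝ) < 2)).comp
        (Nat.tendsto_div_const_atTop (by omega))
    have h2 : Filter.Tendsto (fun n : ℕ => ((1:ℝ) + 2 ^ r) / (Real.log n) ^ 2) Filter.atTop (nhds 0) := by
      apply Filter.Tendsto.const_div_atTop
      exact (Filter.tendsto_pow_atTop (by norm_num)).comp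
        (Real.tendsto_log_atTop.comp tendsto_natCast_atTop_atTop)
    have h3 : Filter.Tendsto (fun n : ℕ => (2:ℝ) / n) Filter.atTop (nhds 0) :=
      tendsto_const_div_atTop_nhds_zero_nat 2
    simpa using h1.add (h2.add h3)
  have hf0 : Filter.Tendsto f (Filter.atTop ⊓ Filter.principal {n : ℕ | r ∣ n}) (nhds 0) := by
    refine tendsto_of_tendsto_of_tendsto_of_le_of_le' tendsto_const_nhds (hb0.mono_left hfl) ?_ ?_
    · refine Filter.Eventually.of_forall (fun n => ?_)
      apply EE_nonneg _ _ (hp n).1 (hp n).2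
      intro G _
      split_ifs <;> norm_num
    · rw [Filter.eventually_inf_principal]
      filter_upwards [Filter.eventually_ge_atTop (max 10000 r)] with n hn hrn
      exact hbound n hn hrn
  simpa using hf0.const_sub 1
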